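/- arXiv:1908.00035 — 2 statements merged into one kernel-verified Lean document; each statement's English description precedes it below -/
import Mathlib

section
/- There exists an absolute constant η ∈ (0, 1/81) such that for every integer q ≥ 3 and every set 𝓑 that is the union of B distinct reduced residue classes modulo q (1 ≤ B ≤ φ(q)), the function G_𝓑(s), defined for Re s > 1, extends to an analytic function on an open set containing the region {s = σ + iτ : σ ≥ 1 − c₀/(1 + log⁺|τ|)}, where c₀ = η/(q^{1/2}(log q)²). -/
noncomputable section

/-- `log⁺ y = max {0, log y}`. -/
def logPlus (y : ℝ) : ℝ := max 0 (Real.log y)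

/-- The region `{s = σ + iτ : σ ≥ 1 - c₀ / (1 + log⁺ |τ|)}`. -/
def sdRegion (c₀ : ℝ) : Set ℂ := {s : ℂ | 1 - c₀ / (1 + logPlus |s.im|) ≤ s.re}

/-- `log ζ(s) = ∑_{n ≥ 2} Λ(n) / (n^s log n)`, for `Re s > 1`. -/
def logZeta (s : ℂ) : ℂ :=
  ∑' n : ℕ, (ArithmeticFunction.vonMangoldt n : ℂ) / ((n : ℂ) ^ s * (Real.log n : ℂ))

/-- `G_𝓑(s) = ζ(s)^{-β} ∏_{p ∈ 𝓑} (1 - p^{-s})⁻¹`, for `Re s > 1`, where the set `𝓑`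
is encoded by the finite set `A` of residue classes mod `q` and `β = |A|/φ(q)`. -/
def GB (q : ℕ) (A : Finset (ZMod q)) (s : ℂ) : ℂ :=
  Complex.exp (-((A.card : ℂ) / (q.totient : ℂ)) * logZeta s) *
    ∏' p : Nat.Primes, (if ((p : ℕ) : ZMod q) ∈ A then (1 - ((p : ℕ) : ℂ) ^ (-s))⁻¹ else 1)

section

open Complex Metric Set Filter Topology

/-- If `f` has no zeros in the ball of radius `r` and `‖f‖ ≤ e^A ‖f 0‖` there, then the
logarithmic derivative at the centre is at most `4 A / r`. -/
lemma norm_logDeriv_zero_le_of_ne_zero {f : ℂ → ℂ} {r A : ℝ} (hr : 0 < r)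
    (hf : DifferentiableOn ℂ f (ball 0 r)) (h0 : ∀ z ∈ ball (0 : ℂ) r, f z ≠ 0)
    (hA : ∀ z ∈ ball (0 : ℂ) r, ‖f z‖ ≤ ‖f 0‖ * Real.exp A) :
    ‖deriv f 0 / f 0‖ ≤ 4 * A / r := by
  have hmem : (0 : ℂ) ∈ ball (0 : ℂ) r := mem_ball_self hr
  have hA0 : 0 ≤ A := by
    have h := hA 0 hmem
    have hpos : 0 < ‖f 0‖ := norm_pos_iff.mpr (h0 0 hmem)
    have : 1 ≤ Real.exp A := by
      by_contra hlt
      push Not at hlt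
      nlinarith
    exact Real.one_le_exp_iff.mp this
  have hd : DifferentiableOn ℂ (fun z ↦ deriv f z / f z) (ball 0 r) :=
    (hf.deriv isOpen_ball).div hf h0
  obtain ⟨k, hk0, hk⟩ := hd.isExactOn_ball.with_val_at 0 0
  have hkd : DifferentiableOn ℂ k (ball 0 r) :=
    fun z hz ↦ (hk z hz).differentiableAt.differentiableWithinAt
  have hexp : ∀ z ∈ ball (0 : ℂ) r, f z = f 0 * exp (k z) := by
    have hder : ∀ z ∈ ball (0 : ℂ) r, HasDerivAt (fun z ↦ f z * exp (-k z)) 0 z := by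
      intro z hz
      have h1 := (hf.differentiableAt (isOpen_ball.mem_nhds hz)).hasDerivAt
      have h2 := (hk z hz).neg.cexp
      refine (h1.mul h2).congr_deriv ?_
      field_simp [h0 z hz]
      simp
    intro z hz
    have hconst := isOpen_ball.is_const_of_deriv_eq_zero (convex_ball (0 : ℂ) r).isPreconnected
      (fun w hw ↦ (hder w hw).differentiableAt.differentiableWithinAt)
      (fun w hw ↦ (hder w hw).deriv) hz hmem
    simp only [hk0, neg_zero, exp_zero, mul_one] at hconst
    rw [← hconst, mul_assoc, ← exp_add]
    simp
  have hre : ∀ z ∈ ball (0 : ℂ) r, (k z).re ≤ A := by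
    intro z hz
    have h := hA z hz
    rw [hexp z hz, norm_mul, norm_exp] at h
    exact Real.exp_le_exp.mp (le_of_mul_le_mul_left h (norm_pos_iff.mpr (h0 0 hmem)))
  have hder0 : deriv k 0 = deriv f 0 / f 0 := (hk 0 hmem).deriv
  rw [← hder0]
  refine le_of_forall_pos_le_add fun ε hε ↦ ?_
  have hA' : 0 < A + ε * r / 4 := by positivity
  have hmaps : MapsTo k (ball 0 (r / 2)) (closedBall (k 0) (2 * (A + ε * r / 4))) := by
    intro z hz
    have hz' : ‖z‖ < r / 2 := by simpa using hz
    have hzr : z ∈ ball (0 : ℂ) r := by simp; linarith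
    have h := borelCaratheodory_zero hA' hkd
      (fun w hw ↦ (hre w hw).trans (by linarith [show 0 < ε * r / 4 by positivity])) hr hzr hk0
    rw [mem_closedBall, hk0, dist_zero_right]
    refine h.trans ?_
    rw [div_le_iff₀ (by linarith)]
    nlinarith
  have h := Complex.norm_deriv_le_div_of_mapsTo_ball
    (hkd.mono (ball_subset_ball (by linarith))) hmaps (by linarith : 0 < r / 2)
  refine h.trans (le_of_eq ?_)
  field_simp
  ring

/-- Division of a bounded function on the unit disc by the Blaschke factor of one of its zeros. -/
lemma exists_blaschke_quotient {f : ℂ → ℂ} {M : ℝ} {ρ : ℂ}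
    (hf : DifferentiableOn ℂ f (ball 0 1)) (hM : ∀ z ∈ ball (0 : ℂ) 1, ‖f z‖ ≤ M)
    (hρ : ‖ρ‖ < 1) (hfρ : f ρ = 0) :
    ∃ g : ℂ → ℂ, DifferentiableOn ℂ g (ball 0 1) ∧ (∀ z ∈ ball (0 : ℂ) 1, ‖g z‖ ≤ M) ∧
      ∀ z ∈ ball (0 : ℂ) 1, f z * (1 - (starRingEnd ℂ) ρ * z) = (z - ρ) * g z := by
  have hρm : ρ ∈ ball (0 : ℂ) 1 := by simpa using hρ
  have hden : ∀ z ∈ ball (0 : ℂ) 1, 1 - (starRingEnd ℂ) ρ * z ≠ 0 := by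
    intro z hz h
    have h1 : ‖(starRingEnd ℂ) ρ * z‖ = 1 := by
      rw [← sub_eq_zero.mp h]; simp
    rw [norm_mul, RCLike.norm_conj] at h1
    have hz' : ‖z‖ < 1 := by simpa using hz
    nlinarith [norm_nonneg z, norm_nonneg ρ]
  set g : ℂ → ℂ := fun z ↦ dslope f ρ z * (1 - (starRingEnd ℂ) ρ * z) with hg
  have hgd : DifferentiableOn ℂ g (ball 0 1) :=
    ((Complex.differentiableOn_dslope (isOpen_ball.mem_nhds hρm)).mpr hf).mul (by fun_prop)
  have hfac : ∀ z, f z * (1 - (starRingEnd ℂ) ρ * z) = (z - ρ) * g z := by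
    intro z
    have := sub_smul_dslope f ρ z
    rw [hfρ, sub_zero, smul_eq_mul] at this
    rw [← this, hg]; ring
  have hmob : ∀ w ∈ ball (0 : ℂ) 1,
      (ρ - w) / (1 - (starRingEnd ℂ) ρ * w) ∈ ball (0 : ℂ) 1 := by
    intro w hw
    have hw' : ‖w‖ < 1 := by simpa using hw
    rw [mem_ball_zero_iff, norm_div, div_lt_one (norm_pos_iff.mpr (hden w hw))]
    rw [← sq_lt_sq₀ (norm_nonneg _) (norm_nonneg _), Complex.sq_norm, Complex.sq_norm]
    have e1 : ‖w‖ ^ 2 < 1 := by nlinarith [norm_nonneg w]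
    have e2 : ‖ρ‖ ^ 2 < 1 := by nlinarith [norm_nonneg ρ]
    rw [Complex.sq_norm, normSq_apply] at e1 e2
    simp only [normSq_apply, sub_re, sub_im, one_re, one_im, mul_re, mul_im, conj_re, conj_im]
    nlinarith
  have hmob2 : ∀ w ∈ ball (0 : ℂ) 1, ∀ v, v = (ρ - w) / (1 - (starRingEnd ℂ) ρ * w) →
      (ρ - v) / (1 - (starRingEnd ℂ) ρ * v) = w := by
    intro w hw v hv
    have h1 := hden w hw
    have hvm : v ∈ ball (0 : ℂ) 1 := hv ▸ hmob w hw
    have h2 := hden v hvm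
    rw [div_eq_iff h2]
    rw [eq_div_iff h1] at hv
    linear_combination (-1 : ℂ) * hv
  have hbound : ∀ z ∈ ball (0 : ℂ) 1, ‖f z‖ ≤ M * ‖(ρ - z) / (1 - (starRingEnd ℂ) ρ * z)‖ := by
    intro z hz
    set F : ℂ → ℂ := fun w ↦ f ((ρ - w) / (1 - (starRingEnd ℂ) ρ * w)) with hF
    have hF0 : F 0 = 0 := by simp [hF, hfρ]
    have hFd : DifferentiableOn ℂ F (ball 0 1) := by
      refine hf.comp (DifferentiableOn.div (by fun_prop) (by fun_prop) hden) hmob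
    have hFm : MapsTo F (ball 0 1) (closedBall (F 0) M) := by
      intro w hw
      rw [hF0, mem_closedBall_zero_iff]
      exact hM _ (hmob w hw)
    have h := Complex.dist_le_div_mul_dist_of_mapsTo_ball hFd hFm (hmob z hz)
    rw [hF0, dist_zero_right, dist_zero_right, div_one] at h
    have hz2 := hmob2 z hz _ rfl
    simp only [hF] at h
    rwa [hz2] at h
  have hne : ∀ z ∈ ball (0 : ℂ) 1, z ≠ ρ → ‖g z‖ ≤ M := by
    intro z hz hzρ
    have h := hbound z hz
    have h1 : 0 < ‖z - ρ‖ := norm_pos_iff.mpr (sub_ne_zero.mpr hzρ)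
    have h2 : 0 < ‖1 - (starRingEnd ℂ) ρ * z‖ := norm_pos_iff.mpr (hden z hz)
    have h3 := congrArg norm (hfac z)
    rw [norm_mul, norm_mul] at h3
    rw [norm_div, norm_sub_rev, ← mul_div_assoc, le_div_iff₀ h2, h3, mul_comm M] at h
    exact le_of_mul_le_mul_left h h1
  refine ⟨g, hgd, fun z hz ↦ ?_, fun z _ ↦ hfac z⟩
  rcases eq_or_ne z ρ with rfl | hzρ
  · have hc : ContinuousAt g z :=
      (hgd.differentiableAt (isOpen_ball.mem_nhds hz)).continuousAt
    refine le_of_tendsto (hc.norm.tendsto.mono_left nhdsWithin_le_nhds : Tendsto _ (𝓝[≠] z) _) ?_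
    filter_upwards [self_mem_nhdsWithin, nhdsWithin_le_nhds (isOpen_ball.mem_nhds hz)]
      with w hw hw'
    exact hne w hw' hw
  · exact hne z hz hzρ

lemma logDeriv_blaschke_quotient {f g : ℂ → ℂ} {ρ : ℂ}
    (hg : DifferentiableOn ℂ g (ball 0 1))
    (hfg : ∀ z ∈ ball (0 : ℂ) 1, f z * (1 - (starRingEnd ℂ) ρ * z) = (z - ρ) * g z)
    (hf : DifferentiableOn ℂ f (ball 0 1)) (hf0 : f 0 ≠ 0) :
    deriv f 0 / f 0 = deriv g 0 / g 0 - (1 / ρ - (starRingEnd ℂ) ρ) := by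
  have hmem : (0 : ℂ) ∈ ball (0 : ℂ) 1 := mem_ball_self one_pos
  have hnhds := isOpen_ball.mem_nhds hmem
  have h0 : f 0 = -ρ * g 0 := by simpa using hfg 0 hmem
  have hρ : ρ ≠ 0 := by rintro rfl; simp [h0] at hf0
  have hg0 : g 0 ≠ 0 := by intro h; simp [h0, h] at hf0
  have h1 : HasDerivAt (fun z ↦ f z * (1 - (starRingEnd ℂ) ρ * z))
      (deriv f 0 * 1 + f 0 * (-(starRingEnd ℂ) ρ)) 0 := by
    have ha := (hf.differentiableAt hnhds).hasDerivAt
    have hb : HasDerivAt (fun z : ℂ ↦ 1 - (starRingEnd ℂ) ρ * z) (-(starRingEnd ℂ) ρ) 0 := by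
      simpa using ((hasDerivAt_id (0 : ℂ)).const_mul ((starRingEnd ℂ) ρ)).const_sub 1
    exact (ha.fun_mul hb).congr_deriv (by simp)
  have h2 : HasDerivAt (fun z ↦ (z - ρ) * g z) (1 * g 0 + (0 - ρ) * deriv g 0) 0 :=
    ((hasDerivAt_id (0 : ℂ)).sub_const ρ).mul (hg.differentiableAt hnhds).hasDerivAt
  have h3 := h1.unique (h2.congr_of_eventuallyEq
    (by filter_upwards [hnhds] with z hz using hfg z hz))
  rw [h0] at h3 ⊢
  field_simp
  linear_combination -h3

/-- If `‖f‖ ≤ e^A ‖f 0‖` on the unit disc and all zeros of `f` have negative real part,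
then `-Re (f'/f)(0) ≤ 8 A`. -/
lemma neg_re_logDeriv_le {f : ℂ → ℂ} {A : ℝ} (hf : DifferentiableOn ℂ f (ball 0 1))
    (hf0 : f 0 ≠ 0) (hA : ∀ z ∈ ball (0 : ℂ) 1, ‖f z‖ ≤ ‖f 0‖ * Real.exp A)
    (hz : ∀ z ∈ ball (0 : ℂ) 1, f z = 0 → z.re < 0) :
    -(deriv f 0 / f 0).re ≤ 8 * A := by
  have key : ∀ n : ℕ, ∀ (f : ℂ → ℂ) (A : ℝ), A < n * Real.log 2 →
      DifferentiableOn ℂ f (ball 0 1) → f 0 ≠ 0 →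
      (∀ z ∈ ball (0 : ℂ) 1, ‖f z‖ ≤ ‖f 0‖ * Real.exp A) →
      (∀ z ∈ ball (0 : ℂ) 1, f z = 0 → z.re < 0) → -(deriv f 0 / f 0).re ≤ 8 * A := by
    intro n
    induction n with
    | zero =>
      intro f A hn hf hf0 hA hz
      exfalso
      have h := hA 0 (mem_ball_self one_pos)
      have hpos : 0 < ‖f 0‖ := norm_pos_iff.mpr hf0
      have : Real.exp A < 1 := Real.exp_lt_one_iff.mpr (by simpa using hn)
      nlinarith
    | succ n ih =>
      intro f A hn hf hf0 hA hz
      by_cases hzero : ∃ ρ ∈ ball (0 : ℂ) (1 / 2), f ρ = 0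
      · obtain ⟨ρ, hρ, hfρ⟩ := hzero
        have hρ' : ‖ρ‖ < 1 / 2 := by simpa using hρ
        obtain ⟨g, hgd, hgM, hfg⟩ := exists_blaschke_quotient hf hA (by linarith) hfρ
        have hρ0 : 0 < ‖ρ‖ := by
          rw [norm_pos_iff]; rintro rfl; exact hf0 hfρ
        have h0 : f 0 = -ρ * g 0 := by simpa using hfg 0 (mem_ball_self one_pos)
        have hg0 : g 0 ≠ 0 := by intro h; simp [h0, h] at hf0
        have hlog : Real.log 2 ≤ -Real.log ‖ρ‖ := by
          rw [← Real.log_inv]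
          refine Real.log_le_log (by norm_num) ?_
          rw [le_inv_comm₀ (by norm_num) hρ0]; linarith
        have hgz : ∀ z ∈ ball (0 : ℂ) 1, g z = 0 → z.re < 0 := by
          intro z hz' hgz
          have hz1 : ‖z‖ < 1 := by simpa using hz'
          refine hz z hz' ?_
          have h := hfg z hz'
          rw [hgz, mul_zero, mul_eq_zero] at h
          refine h.resolve_right fun h ↦ ?_
          have h1 : ‖(starRingEnd ℂ) ρ * z‖ = 1 := by
            rw [← sub_eq_zero.mp h]; simp
          rw [norm_mul, RCLike.norm_conj] at h1
          nlinarith [norm_nonneg z, norm_nonneg ρ]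
        have hgA : ∀ z ∈ ball (0 : ℂ) 1, ‖g z‖ ≤ ‖g 0‖ * Real.exp (A + Real.log ‖ρ‖) := by
          intro z hz'
          refine (hgM z hz').trans (le_of_eq ?_)
          rw [h0, norm_mul, norm_neg, Real.exp_add, Real.exp_log hρ0]; ring
        have hi := ih g (A + Real.log ‖ρ‖) (by push_cast at hn; linarith) hgd hg0 hgA hgz
        have hlogd := logDeriv_blaschke_quotient hgd hfg hf hf0
        have hρre := hz ρ (by simp; linarith) hfρ
        have hpos : 0 ≤ -(1 / ρ - (starRingEnd ℂ) ρ).re := by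
          rw [one_div, sub_re, inv_re, conj_re]
          have hn : 0 < normSq ρ := normSq_pos.mpr (by rintro rfl; exact hf0 hfρ)
          have hn1 : normSq ρ < 1 := by
            rw [← Complex.sq_norm]; nlinarith
          have : 1 ≤ 1 / normSq ρ := by rw [le_div_iff₀ hn]; linarith
          rw [div_eq_mul_one_div]
          nlinarith
        rw [hlogd, sub_re]
        have := Real.log_pos (one_lt_two)
        linarith
      · push Not at hzero
        have hsub : ball (0 : ℂ) (1 / 2) ⊆ ball 0 1 := ball_subset_ball (by norm_num)
        have h := norm_logDeriv_zero_le_of_ne_zero (r := 1 / 2) (by norm_num) (hf.mono hsub) hzero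
          (fun z hz' ↦ hA z (hsub hz'))
        have h1 := (abs_le.mp (Complex.abs_re_le_norm (deriv f 0 / f 0))).1
        linarith
  obtain ⟨n, hn⟩ := exists_nat_gt (A / Real.log 2)
  exact key n f A ((div_lt_iff₀ (Real.log_pos one_lt_two)).mp hn) hf hf0 hA hz

/-- The refinement of `neg_re_logDeriv_le` which keeps track of one real zero `-δ`. -/
lemma neg_re_logDeriv_le_sub {f : ℂ → ℂ} {A δ : ℝ} (hf : DifferentiableOn ℂ f (ball 0 1))
    (hf0 : f 0 ≠ 0) (hA : ∀ z ∈ ball (0 : ℂ) 1, ‖f z‖ ≤ ‖f 0‖ * Real.exp A)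
    (hz : ∀ z ∈ ball (0 : ℂ) 1, f z = 0 → z.re < 0) (hδ0 : 0 < δ) (hδ1 : δ < 1)
    (hδ : f (-δ : ℝ) = 0) :
    -(deriv f 0 / f 0).re ≤ 8 * A - 1 / δ + δ := by
  have hnorm : ‖((-δ : ℝ) : ℂ)‖ = δ := by
    rw [norm_real, Real.norm_eq_abs, abs_neg, abs_of_pos hδ0]
  obtain ⟨g, hgd, hgM, hfg⟩ := exists_blaschke_quotient hf hA (by rw [hnorm]; exact hδ1) hδ
  have h0 : f 0 = -((-δ : ℝ) : ℂ) * g 0 := by simpa using hfg 0 (mem_ball_self one_pos)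
  have hg0 : g 0 ≠ 0 := by intro h; simp [h0, h] at hf0
  have hgz : ∀ z ∈ ball (0 : ℂ) 1, g z = 0 → z.re < 0 := by
    intro z hz' hgz
    have hz1 : ‖z‖ < 1 := by simpa using hz'
    refine hz z hz' ?_
    have h := hfg z hz'
    rw [hgz, mul_zero, mul_eq_zero] at h
    refine h.resolve_right fun h ↦ ?_
    have h1 : ‖(starRingEnd ℂ) ((-δ : ℝ) : ℂ) * z‖ = 1 := by
      rw [← sub_eq_zero.mp h]; simp
    rw [norm_mul, RCLike.norm_conj, hnorm] at h1
    nlinarith [norm_nonneg z]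
  have hle : ‖f 0‖ ≤ ‖g 0‖ := by
    rw [h0, norm_mul, norm_neg, hnorm]
    nlinarith [norm_nonneg (g 0)]
  have hi := neg_re_logDeriv_le hgd hg0 (fun z hz' ↦ (hgM z hz').trans
    (by gcongr)) hgz
  rw [logDeriv_blaschke_quotient hgd hfg hf hf0, sub_re, sub_re, conj_re, ofReal_re, one_div,
    ← ofReal_inv, ofReal_re, inv_neg]
  rw [one_div]
  linarith

end

section

open Complex Set Filter Topology MeasureTheory Asymptotics

lemma sum_Icc_one_eq_sum_range (f : ℕ → ℂ) (n : ℕ) :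
    ∑ k ∈ Finset.Icc 1 n, f k = ∑ k ∈ Finset.range n, f (k + 1) := by
  induction n with
  | zero => simp
  | succ n ih => rw [Finset.sum_Icc_succ_top (by omega), ih, Finset.sum_range_succ]

lemma sum_range_zmod_shift {q : ℕ} [NeZero q] (Φ : ZMod q → ℂ) (a : ZMod q) :
    ∑ k ∈ Finset.range q, Φ (a + k) = ∑ j, Φ j := by
  rw [← Equiv.sum_comp (Equiv.addLeft a) Φ]
  refine Finset.sum_bij' (fun k _ ↦ (k : ZMod q)) (fun j _ ↦ j.val) ?_ ?_ ?_ ?_ ?_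
  · simp
  · intro j _; simpa using ZMod.val_lt j
  · intro k hk; exact ZMod.val_cast_of_lt (Finset.mem_range.mp hk)
  · simp
  · simp

lemma norm_sum_Icc_zmod_sub_le {q : ℕ} [NeZero q] {Φ : ZMod q → ℂ} (hΦ : ∀ a, ‖Φ a‖ ≤ 1) (n : ℕ) :
    ‖∑ k ∈ Finset.Icc 1 n, Φ k - (∑ j, Φ j) / q * n‖ ≤ 2 * q := by
  have hq : (q : ℂ) ≠ 0 := by exact_mod_cast NeZero.ne q
  have hq' : (0 : ℝ) < q := by exact_mod_cast Nat.pos_of_neZero q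
  rw [sum_Icc_one_eq_sum_range (fun k ↦ Φ k)]
  induction n using Nat.strong_induction_on with
  | _ n ih =>
    rcases lt_or_ge n q with hn | hn
    · refine (norm_sub_le _ _).trans ?_
      have hn' : (n : ℝ) ≤ q := by exact_mod_cast hn.le
      have h1 : ‖∑ k ∈ Finset.range n, Φ ((k + 1 : ℕ) : ZMod q)‖ ≤ n := by
        refine (norm_sum_le _ _).trans ((Finset.sum_le_sum fun k _ ↦ hΦ _).trans ?_)
        simp
      have h2 : ‖∑ j, Φ j‖ ≤ q := by
        refine (norm_sum_le _ _).trans ((Finset.sum_le_sum fun k _ ↦ hΦ _).trans ?_)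
        simp [ZMod.card]
      have h3 : ‖(∑ j, Φ j) / q * n‖ ≤ n := by
        rw [norm_mul, norm_div, norm_natCast, norm_natCast]
        have : ‖∑ j, Φ j‖ / q ≤ 1 := (div_le_one hq').mpr h2
        nlinarith [(Nat.cast_nonneg n : (0 : ℝ) ≤ n)]
      linarith
    · obtain ⟨m, rfl⟩ := Nat.exists_eq_add_of_le hn
      have h := ih m (by have := Nat.pos_of_neZero q; omega)
      have hs := sum_range_zmod_shift Φ ((m + 1 : ℕ) : ZMod q)
      rw [add_comm q m, Finset.sum_range_add]
      have e : ∑ x ∈ Finset.range q, Φ ((m + x + 1 : ℕ) : ZMod q) = ∑ j, Φ j := by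
        rw [← hs]
        refine Finset.sum_congr rfl fun x _ ↦ ?_
        push_cast
        ring_nf
      rw [e]
      convert h using 2
      push_cast
      field_simp
      ring

/-- The Mellin-type integral of the remainder `∑_{k ≤ t} f k - κ t`. -/
noncomputable def remainderIntegral (f : ℕ → ℂ) (κ : ℂ) (s : ℂ) : ℂ :=
  ∫ t in Ioi (1 : ℝ), (∑ k ∈ Finset.Icc 1 ⌊t⌋₊, f k - κ * t) * (t : ℂ) ^ (-(s + 1))

lemma measurable_sum_Icc_floor_sub (f : ℕ → ℂ) (κ : ℂ) :
    Measurable fun t : ℝ ↦ ∑ k ∈ Finset.Icc 1 ⌊t⌋₊, f k - κ * t :=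
  ((measurable_from_nat (f := fun n ↦ ∑ k ∈ Finset.Icc 1 n, f k)).comp
    Nat.measurable_floor).sub (by fun_prop)

lemma norm_cpow_neg_add_one {t : ℝ} (ht : 0 < t) (s : ℂ) :
    ‖(t : ℂ) ^ (-(s + 1))‖ = t ^ (-s.re - 1) := by
  rw [norm_cpow_eq_rpow_re_of_pos ht]
  congr 1
  simp; ring

lemma integrableOn_remainder {f : ℕ → ℂ} {κ : ℂ} {B : ℝ}
    (hB : ∀ t : ℝ, 1 < t → ‖∑ k ∈ Finset.Icc 1 ⌊t⌋₊, f k - κ * t‖ ≤ B) {s : ℂ} (hs : 0 < s.re) :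
    IntegrableOn (fun t : ℝ ↦ (∑ k ∈ Finset.Icc 1 ⌊t⌋₊, f k - κ * t) * (t : ℂ) ^ (-(s + 1)))
      (Ioi 1) := by
  have hi : IntegrableOn (fun t : ℝ ↦ B * t ^ (-s.re - 1)) (Ioi 1) :=
    (integrableOn_Ioi_rpow_of_lt (by linarith) one_pos).const_mul B
  refine Integrable.mono' hi ?_ ?_
  · refine ((measurable_sum_Icc_floor_sub f κ).mul ?_).aestronglyMeasurable
    exact (Complex.measurable_ofReal).pow_const _
  · refine (ae_restrict_iff' measurableSet_Ioi).mpr (.of_forall fun t ht ↦ ?_)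
    have ht' : (1 : ℝ) < t := ht
    rw [norm_mul, norm_cpow_neg_add_one (by linarith)]
    exact mul_le_mul_of_nonneg_right (hB t ht) (by positivity)

lemma norm_remainderIntegral_le {f : ℕ → ℂ} {κ : ℂ} {B : ℝ}
    (hB : ∀ t : ℝ, 1 < t → ‖∑ k ∈ Finset.Icc 1 ⌊t⌋₊, f k - κ * t‖ ≤ B) {s : ℂ} (hs : 0 < s.re) :
    ‖remainderIntegral f κ s‖ ≤ B / s.re := by
  have hi : IntegrableOn (fun t : ℝ ↦ B * t ^ (-s.re - 1)) (Ioi 1) :=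
    (integrableOn_Ioi_rpow_of_lt (by linarith) one_pos).const_mul B
  refine (norm_integral_le_of_norm_le hi ?_).trans (le_of_eq ?_)
  · refine (ae_restrict_iff' measurableSet_Ioi).mpr (.of_forall fun t ht ↦ ?_)
    have ht' : (1 : ℝ) < t := ht
    rw [norm_mul, norm_cpow_neg_add_one (by linarith)]
    exact mul_le_mul_of_nonneg_right (hB t ht) (by positivity)
  · rw [integral_const_mul, integral_Ioi_rpow_of_lt (by linarith) one_pos]
    simp
    field_simp

lemma differentiableAt_remainderIntegral {f : ℕ → ℂ} {κ : ℂ} {B : ℝ}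
    (hB : ∀ t : ℝ, 1 < t → ‖∑ k ∈ Finset.Icc 1 ⌊t⌋₊, f k - κ * t‖ ≤ B) {s : ℂ} (hs : 0 < s.re) :
    DifferentiableAt ℂ (remainderIntegral f κ) s := by
  set R : ℝ → ℂ := (Ioi (1 : ℝ)).indicator
    fun t ↦ ∑ k ∈ Finset.Icc 1 ⌊t⌋₊, f k - κ * t with hR
  have hRb : ∀ t, ‖R t‖ ≤ max B 0 := by
    intro t
    by_cases ht : t ∈ Ioi (1 : ℝ)
    · rw [hR, indicator_of_mem ht]; exact (hB t ht).trans (le_max_left _ _)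
    · rw [hR, indicator_of_notMem ht]; simp
  have hRm : Measurable R := (measurable_sum_Icc_floor_sub f κ).indicator measurableSet_Ioi
  have heq : remainderIntegral f κ = fun s ↦ mellin R (-s) := by
    ext s
    rw [mellin, remainderIntegral]
    have : ∀ t : ℝ, (t : ℂ) ^ (-s - 1) • R t = (Ioi (1 : ℝ)).indicator
        (fun t : ℝ ↦ (∑ k ∈ Finset.Icc 1 ⌊t⌋₊, f k - κ * t) * (t : ℂ) ^ (-(s + 1))) t := by
      intro t
      by_cases ht : t ∈ Ioi (1 : ℝ)
      · rw [hR, indicator_of_mem ht, indicator_of_mem ht, smul_eq_mul, mul_comm]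
        congr 2; ring
      · rw [hR, indicator_of_notMem ht, indicator_of_notMem ht, smul_zero]
    simp_rw [this]
    rw [setIntegral_indicator measurableSet_Ioi]
    congr 2
    exact (inter_eq_right.mpr (Ioi_subset_Ioi zero_le_one)).symm
  rw [heq]
  have hd : DifferentiableAt ℂ (mellin R) (-s) := by
    refine mellin_differentiableAt_of_isBigO_rpow (a := 0) (b := -s.re - 1) ?_ ?_ ?_ ?_ ?_
    · refine LocallyIntegrable.locallyIntegrableOn ?_ _
      refine (locallyIntegrable_const (max B 0)).mono hRm.aestronglyMeasurable
        (.of_forall fun t ↦ ?_)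
      rw [Real.norm_of_nonneg (le_max_right _ _)]
      exact hRb t
    · refine IsBigO.of_bound (max B 0) (.of_forall fun t ↦ ?_)
      simpa using hRb t
    · simpa using hs
    · refine (isBigO_zero _ _).congr' ?_ .rfl
      have : Iio (1 : ℝ) ∈ 𝓝[>] (0 : ℝ) :=
        nhdsWithin_le_nhds (isOpen_Iio.mem_nhds (by simp))
      filter_upwards [this] with t ht
      rw [hR, indicator_of_notMem]
      simpa using le_of_lt ht
    · simp
  exact hd.comp s differentiableAt_id.neg

lemma LSeries_eq_add_remainderIntegral {f : ℕ → ℂ} {κ : ℂ} {B : ℝ} (hf : ∀ n, ‖f n‖ ≤ 1)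
    (hB : ∀ t : ℝ, 1 < t → ‖∑ k ∈ Finset.Icc 1 ⌊t⌋₊, f k - κ * t‖ ≤ B) {s : ℂ} (hs : 1 < s.re) :
    LSeries f s = κ * (s / (s - 1)) + s * remainderIntegral f κ s := by
  have hO : (fun n : ℕ ↦ ∑ k ∈ Finset.Icc 1 n, ‖f k‖) =O[atTop] fun n ↦ (n : ℝ) ^ (1 : ℝ) := by
    refine IsBigO.of_bound 1 (.of_forall fun n ↦ ?_)
    rw [Real.rpow_one, one_mul, Real.norm_of_nonneg (by positivity), Real.norm_of_nonneg (by simp)]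
    exact (Finset.sum_le_sum fun k _ ↦ hf k).trans (by simp)
  rw [LSeries_eq_mul_integral' f zero_le_one hs hO]
  have hs1 : s - 1 ≠ 0 := by
    intro h; rw [sub_eq_zero.mp h] at hs; simp at hs
  have hint : IntegrableOn (fun t : ℝ ↦ κ * (t : ℂ) ^ (-s)) (Ioi 1) :=
    (integrableOn_Ioi_cpow_of_lt (by simpa using hs) one_pos).const_mul κ
  have hsplit : ∫ t in Ioi (1 : ℝ), (∑ k ∈ Finset.Icc 1 ⌊t⌋₊, f k) * (t : ℂ) ^ (-(s + 1)) =
      κ * (1 / (s - 1)) + remainderIntegral f κ s := by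
    have h2 : ∫ t in Ioi (1 : ℝ), κ * (t : ℂ) ^ (-s) = κ * (1 / (s - 1)) := by
      rw [integral_const_mul, integral_Ioi_cpow_of_lt (by simpa using hs) one_pos]
      have h' : -s + 1 ≠ 0 := by intro h; apply hs1; linear_combination -h
      congr 1
      rw [ofReal_one, one_cpow]
      field_simp
      ring
    rw [← h2, remainderIntegral, ← integral_add hint (integrableOn_remainder hB (by linarith))]
    refine setIntegral_congr_fun measurableSet_Ioi fun t ht ↦ ?_
    have ht0 : (t : ℂ) ≠ 0 := by
      have : (1 : ℝ) < t := ht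
      exact_mod_cast (by linarith : (0 : ℝ) < t).ne'
    have : (t : ℂ) ^ (-s) = t * (t : ℂ) ^ (-(s + 1)) := by
      rw [show -s = 1 + (-(s + 1)) by ring, cpow_add _ _ ht0, cpow_one]
    simp only [this]
    ring
  rw [hsplit]
  field_simp

end

section

open Complex Set Filter Topology MeasureTheory Asymptotics

namespace DirichletCharacter

variable {q : ℕ} [NeZero q]

lemma norm_sum_Icc_floor_sub_le (χ : DirichletCharacter ℂ q) (t : ℝ) (ht : 1 < t) :
    ‖∑ k ∈ Finset.Icc 1 ⌊t⌋₊, χ k - (∑ j, χ j) / q * t‖ ≤ 3 * q := by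
  have hq : (1 : ℝ) ≤ q := by exact_mod_cast Nat.pos_of_neZero q
  have h1 := norm_sum_Icc_zmod_sub_le (Φ := χ) (fun a ↦ χ.norm_le_one a) ⌊t⌋₊
  have h2 : ‖(∑ j, χ j) / q‖ ≤ 1 := by
    rw [norm_div, Complex.norm_natCast, div_le_one (by linarith)]
    refine (norm_sum_le _ _).trans ((Finset.sum_le_sum fun j _ ↦ χ.norm_le_one j).trans ?_)
    simp
  have h3 : ‖((⌊t⌋₊ : ℂ) - (t : ℂ))‖ ≤ 1 := by
    have h4 := Nat.floor_le (show 0 ≤ t by linarith)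
    have h5 := Nat.lt_floor_add_one t
    rw [show ((⌊t⌋₊ : ℂ) - (t : ℂ)) = (((⌊t⌋₊ : ℝ) - t : ℝ) : ℂ) by push_cast; rfl,
      Complex.norm_real, Real.norm_eq_abs, abs_le]
    constructor <;> linarith
  calc _ = ‖(∑ k ∈ Finset.Icc 1 ⌊t⌋₊, χ k - (∑ j, χ j) / q * ⌊t⌋₊)
        + (∑ j, χ j) / q * ((⌊t⌋₊ : ℂ) - t)‖ := by congr 1; ring
    _ ≤ 2 * q + 1 * 1 := by
        refine (norm_add_le _ _).trans (add_le_add h1 ?_)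
        rw [norm_mul]
        exact mul_le_mul h2 h3 (norm_nonneg _) zero_le_one
    _ ≤ _ := by linarith

lemma norm_sum_Icc_floor_le {χ : DirichletCharacter ℂ q} (hχ : χ ≠ 1) (t : ℝ) (ht : 1 < t) :
    ‖∑ k ∈ Finset.Icc 1 ⌊t⌋₊, χ k - 0 * t‖ ≤ 3 * q := by
  have := norm_sum_Icc_floor_sub_le χ t ht
  rwa [MulChar.sum_eq_zero_of_ne_one hχ, zero_div] at this

lemma isPreconnected_re_pos : IsPreconnected {s : ℂ | 0 < s.re} :=
  (convex_halfSpace_re_gt 0).isPreconnected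

lemma LFunction_eq_mul_remainderIntegral {χ : DirichletCharacter ℂ q} (hχ : χ ≠ 1) {s : ℂ}
    (hs : 0 < s.re) : LFunction χ s = s * remainderIntegral (fun n ↦ χ n) 0 s := by
  have ho : IsOpen {s : ℂ | 0 < s.re} := isOpen_lt continuous_const continuous_re
  have h1 : AnalyticOnNhd ℂ (LFunction χ) {s : ℂ | 0 < s.re} :=
    (differentiable_LFunction hχ).differentiableOn.analyticOnNhd ho
  have h2 : AnalyticOnNhd ℂ (fun s ↦ s * remainderIntegral (fun n ↦ χ n) 0 s)
      {s : ℂ | 0 < s.re} := by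
    refine DifferentiableOn.analyticOnNhd (fun z hz ↦ ?_) ho
    exact (differentiableAt_id.mul (differentiableAt_remainderIntegral
      (norm_sum_Icc_floor_le hχ) hz)).differentiableWithinAt
  refine h1.eqOn_of_preconnected_of_eventuallyEq h2 isPreconnected_re_pos
    (z₀ := 2) (by simp) ?_ hs
  have : {s : ℂ | 1 < s.re} ∈ 𝓝 (2 : ℂ) :=
    (isOpen_lt continuous_const continuous_re).mem_nhds (by simp)
  filter_upwards [this] with z hz
  rw [LFunction_eq_LSeries χ hz, LSeries_eq_add_remainderIntegral (fun n ↦ χ.norm_le_one n)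
    (norm_sum_Icc_floor_le hχ) hz]
  simp

lemma LFunctionTrivChar₁_eq_add_remainderIntegral {s : ℂ} (hs : 0 < s.re) :
    LFunctionTrivChar₁ q s = (∑ j, (1 : DirichletCharacter ℂ q) j) / q * s +
      s * (s - 1) * remainderIntegral (fun n ↦ (1 : DirichletCharacter ℂ q) n)
        ((∑ j, (1 : DirichletCharacter ℂ q) j) / q) s := by
  have ho : IsOpen {s : ℂ | 0 < s.re} := isOpen_lt continuous_const continuous_re
  have h1 : AnalyticOnNhd ℂ (LFunctionTrivChar₁ q) {s : ℂ | 0 < s.re} :=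
    (differentiable_LFunctionTrivChar₁ q).differentiableOn.analyticOnNhd ho
  have h2 : AnalyticOnNhd ℂ (fun s ↦ (∑ j, (1 : DirichletCharacter ℂ q) j) / q * s +
      s * (s - 1) * remainderIntegral (fun n ↦ (1 : DirichletCharacter ℂ q) n)
        ((∑ j, (1 : DirichletCharacter ℂ q) j) / q) s) {s : ℂ | 0 < s.re} := by
    refine DifferentiableOn.analyticOnNhd (fun z hz ↦ ?_) ho
    have := differentiableAt_remainderIntegral
      (norm_sum_Icc_floor_sub_le (1 : DirichletCharacter ℂ q)) hz
    exact DifferentiableAt.differentiableWithinAt (by fun_prop)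
  refine h1.eqOn_of_preconnected_of_eventuallyEq h2 isPreconnected_re_pos
    (z₀ := 2) (by simp) ?_ hs
  have : {s : ℂ | 1 < s.re} ∈ 𝓝 (2 : ℂ) :=
    (isOpen_lt continuous_const continuous_re).mem_nhds (by simp)
  filter_upwards [this] with z hz
  have hz1 : z ≠ 1 := by rintro rfl; simp at hz
  rw [LFunctionTrivChar₁, Function.update_of_ne hz1, LFunctionTrivChar, LFunction_eq_LSeries _ hz,
    LSeries_eq_add_remainderIntegral (fun n ↦ norm_le_one _ (n : ZMod q))
    (norm_sum_Icc_floor_sub_le (1 : DirichletCharacter ℂ q)) hz]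
  have := sub_ne_zero.mpr hz1
  field_simp

/-- The entire function `L(s, χ)`, respectively `(s - 1) L(s, χ)` when `χ` is trivial. -/
noncomputable def entireL (χ : DirichletCharacter ℂ q) : ℂ → ℂ :=
  open Classical in if χ = 1 then LFunctionTrivChar₁ q else LFunction χ

lemma differentiable_entireL (χ : DirichletCharacter ℂ q) : Differentiable ℂ (entireL χ) := by
  unfold entireL
  split_ifs with h
  · exact differentiable_LFunctionTrivChar₁ q
  · exact differentiable_LFunction h

lemma norm_entireL_le (χ : DirichletCharacter ℂ q) {s : ℂ} (hs : 1 / 2 ≤ s.re) :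
    ‖entireL χ s‖ ≤ 7 * q * (‖s‖ + 1) ^ 2 := by
  have hq : (1 : ℝ) ≤ q := by exact_mod_cast Nat.pos_of_neZero q
  have hs0 : 0 < s.re := by linarith
  have hdiv : (3 * q : ℝ) / s.re ≤ 6 * q := by
    rw [div_le_iff₀ hs0]; nlinarith
  unfold entireL
  have hn := norm_nonneg s
  split_ifs with h
  · rw [LFunctionTrivChar₁_eq_add_remainderIntegral hs0]
    have h2 : ‖(∑ j, (1 : DirichletCharacter ℂ q) j) / q‖ ≤ 1 := by
      rw [norm_div, Complex.norm_natCast, div_le_one (by linarith)]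
      refine (norm_sum_le _ _).trans ((Finset.sum_le_sum fun j _ ↦ norm_le_one _ j).trans ?_)
      simp
    have h3 := (norm_remainderIntegral_le
      (norm_sum_Icc_floor_sub_le (1 : DirichletCharacter ℂ q)) hs0).trans hdiv
    have h4 : ‖s - 1‖ ≤ ‖s‖ + 1 := (norm_sub_le _ _).trans (by simp)
    refine (norm_add_le _ _).trans ?_
    rw [norm_mul, norm_mul, norm_mul]
    calc _ ≤ 1 * ‖s‖ + ‖s‖ * (‖s‖ + 1) * (6 * q) := by gcongr
      _ ≤ _ := by nlinarith [mul_nonneg hn hn, mul_nonneg hn (mul_nonneg hn (sub_nonneg.mpr hq)),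
          mul_nonneg hn (sub_nonneg.mpr hq)]
  · rw [LFunction_eq_mul_remainderIntegral h hs0, norm_mul]
    have h3 := (norm_remainderIntegral_le (norm_sum_Icc_floor_le h) hs0).trans hdiv
    calc _ ≤ ‖s‖ * (6 * q) := by gcongr
      _ ≤ _ := by nlinarith [mul_nonneg hn hn, mul_nonneg hn (mul_nonneg hn (sub_nonneg.mpr hq)),
          mul_nonneg hn (sub_nonneg.mpr hq)]

lemma norm_LFunction_le_near_one {χ : DirichletCharacter ℂ q} (hχ : χ ≠ 1) {ε : ℝ} (hε : 0 < ε)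
    (hε' : ε ≤ 1 / 2) {s : ℂ} (hs : 1 - ε ≤ s.re) :
    ‖LFunction χ s‖ ≤ ‖s‖ * ((3 * q : ℝ) ^ (2 * ε) / ε) := by
  have hq : (1 : ℝ) ≤ q := by exact_mod_cast Nat.pos_of_neZero q
  rw [LFunction_eq_mul_remainderIntegral hχ (by linarith), norm_mul]
  gcongr
  have hi : IntegrableOn (fun t : ℝ ↦ (3 * q : ℝ) ^ (2 * ε) * t ^ (-1 - ε)) (Ioi 1) :=
    (integrableOn_Ioi_rpow_of_lt (by linarith) one_pos).const_mul _
  refine (norm_integral_le_of_norm_le hi ?_).trans (le_of_eq ?_)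
  · refine (ae_restrict_iff' measurableSet_Ioi).mpr (.of_forall fun t ht ↦ ?_)
    have ht' : (1 : ℝ) < t := ht
    have h1 := norm_sum_Icc_floor_le hχ t ht
    have h2 : ‖∑ k ∈ Finset.Icc 1 ⌊t⌋₊, χ k - 0 * t‖ ≤ t := by
      rw [zero_mul, sub_zero]
      refine (norm_sum_le_of_le _ (n := fun _ ↦ 1)
        fun (j : ℕ) _ ↦ χ.norm_le_one (j : ZMod q)).trans ?_
      simpa using Nat.floor_le (by linarith)
    rw [norm_mul, norm_cpow_neg_add_one (by linarith)]
    set a := ‖∑ k ∈ Finset.Icc 1 ⌊t⌋₊, χ k - 0 * t‖ with ha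
    have ha0 : 0 ≤ a := norm_nonneg _
    have h3 : a ≤ (3 * q : ℝ) ^ (2 * ε) * t ^ (1 - 2 * ε) := by
      calc a = a ^ (2 * ε) * a ^ (1 - 2 * ε) := by
            rw [← Real.rpow_add' ha0 (by norm_num)]; simp
        _ ≤ _ := by gcongr; linarith
    calc a * t ^ (-s.re - 1) ≤ ((3 * q : ℝ) ^ (2 * ε) * t ^ (1 - 2 * ε)) * t ^ (ε - 2) := by
          refine mul_le_mul h3 ?_ (by positivity) (by positivity)
          exact Real.rpow_le_rpow_of_exponent_le ht'.le (by linarith)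
      _ = _ := by
          rw [mul_assoc, ← Real.rpow_add (by linarith)]; congr 2; ring
  · rw [integral_const_mul, integral_Ioi_rpow_of_lt (by linarith) one_pos, Real.one_rpow]
    have : -1 - ε + 1 = -ε := by ring
    rw [this]; field_simp

lemma tendsto_sum_div_LFunction_one {χ : DirichletCharacter ℂ q} (hχ : χ ≠ 1) :
    Tendsto (fun n : ℕ ↦ ∑ k ∈ Finset.Icc 1 n, χ k / k) atTop (𝓝 (LFunction χ 1)) := by
  have hq1 : q ≠ 1 := by
    rintro rfl
    exact hχ (level_one χ)
  have hc0 : χ ((0 : ℕ) : ZMod q) = 0 := by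
    rw [Nat.cast_zero]
    have : Nontrivial (ZMod q) := ZMod.nontrivial_iff.mpr hq1
    exact MulChar.map_zero χ
  have hsum (g : ℕ → ℂ) (hg : g 0 = 0) (n : ℕ) :
      ∑ k ∈ Finset.Icc 0 n, g k = ∑ k ∈ Finset.Icc 1 n, g k := by
    rw [← Finset.add_sum_Ioc_eq_sum_Icc (Nat.zero_le n), hg, zero_add]; rfl
  have hd (t : ℝ) (ht : t ≠ 0) :
      HasDerivAt (fun t : ℝ ↦ ((t : ℂ))⁻¹) (-((t : ℂ) ^ 2)⁻¹) t := by
    have := (hasDerivAt_inv (x := (t : ℂ)) (by exact_mod_cast ht)).comp_ofReal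
    simpa using this
  have hb : ∀ t : ℝ, 1 < t → ‖∑ k ∈ Finset.Icc 0 ⌊t⌋₊, χ k‖ ≤ 3 * q := by
    intro t ht
    have := norm_sum_Icc_floor_le hχ t ht
    rwa [zero_mul, sub_zero, ← hsum (fun k ↦ χ k) hc0] at this
  have key := tendsto_sum_mul_atTop_nhds_one_sub_integral₀ (f := fun t : ℝ ↦ ((t : ℂ))⁻¹)
    (fun k ↦ χ (k : ZMod q)) (l := 0) (g := fun t : ℝ ↦ t ^ (-2 : ℝ)) hc0
    (fun t ht ↦ (hd t (by have : (1 : ℝ) ≤ t := ht; linarith)).differentiableAt) ?_ ?_ ?_ ?_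
  · have e : (0 : ℂ) - ∫ t in Ioi (1 : ℝ), deriv (fun t : ℝ ↦ ((t : ℂ))⁻¹) t *
        ∑ k ∈ Finset.Icc 0 ⌊t⌋₊, χ k = LFunction χ 1 := by
      rw [LFunction_eq_mul_remainderIntegral hχ (by simp), one_mul, remainderIntegral, zero_sub,
        ← integral_neg]
      refine setIntegral_congr_fun measurableSet_Ioi fun t ht ↦ ?_
      have ht' : (1 : ℝ) < t := ht
      rw [(hd t (by linarith)).deriv, hsum (fun k ↦ χ k) hc0]
      rw [show (-((1 : ℂ) + 1)) = ((-2 : ℤ) : ℂ) by norm_num, cpow_intCast]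
      simp [zpow_neg, mul_comm]
    rw [e] at key
    refine key.congr fun n ↦ ?_
    rw [hsum (fun k ↦ (((k : ℝ) : ℂ))⁻¹ * χ k) (by simp)]
    refine Finset.sum_congr rfl fun k _ ↦ ?_
    simp [div_eq_mul_inv, mul_comm]
  · refine ContinuousOn.locallyIntegrableOn ?_ measurableSet_Ici
    have : ContinuousOn (fun t : ℝ ↦ (-((t : ℂ) ^ 2)⁻¹)) (Ici 1) := by
      refine ContinuousOn.neg (ContinuousOn.inv₀ (by fun_prop) fun t ht ↦ ?_)
      have : (1 : ℝ) ≤ t := ht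
      have : (t : ℂ) ≠ 0 := by exact_mod_cast (by linarith : t ≠ 0)
      exact pow_ne_zero 2 this
    refine this.congr fun t ht ↦ (hd t ?_).deriv
    have : (1 : ℝ) ≤ t := ht
    linarith
  · rw [tendsto_zero_iff_norm_tendsto_zero]
    refine squeeze_zero' (.of_forall fun n ↦ norm_nonneg _) ?_
      (tendsto_const_div_atTop_nhds_zero_nat (3 * q : ℝ))
    filter_upwards [eventually_ge_atTop 2] with n hn
    have := hb n (by exact_mod_cast hn)
    rw [Nat.floor_natCast] at this
    rw [norm_mul, norm_inv]
    simp only [ofReal_natCast, Complex.norm_natCast]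
    rw [div_eq_inv_mul]
    gcongr
  · refine IsBigO.of_bound (3 * q) ?_
    filter_upwards [eventually_gt_atTop 1] with t ht
    rw [(hd t (by linarith)).deriv, norm_mul, norm_neg, norm_inv, norm_pow, norm_real,
      Real.norm_of_nonneg (by linarith : 0 ≤ t), Real.norm_of_nonneg (by positivity),
      Real.rpow_neg (by linarith), mul_comm]
    have := hb t ht
    norm_cast at this ⊢
    gcongr
  · exact ⟨Ioi 1, Ioi_mem_atTop 1, integrableOn_Ioi_rpow_of_lt (by norm_num) one_pos⟩

end DirichletCharacter

end

section

open Real Set Filter Topology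

/-- The function `(1 / sinh t - 1 / t) / 2`, which vanishes continuously at `0`. -/
noncomputable def cschRemainder (t : ℝ) : ℝ := ((sinh t)⁻¹ - t⁻¹) / 2

lemma abs_sinh_sub_le {t : ℝ} (h0 : 0 ≤ t) (h1 : t ≤ 1) :
    |sinh t - t - t ^ 3 / 6| ≤ t ^ 5 / 100 := by
  have ha : |t| = t := abs_of_nonneg h0
  have e1 := Real.exp_bound (x := t) (by rw [ha]; exact h1) (n := 5) (by norm_num)
  have e2 := Real.exp_bound (x := -t) (by rw [abs_neg, ha]; exact h1) (n := 5) (by norm_num)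
  rw [abs_neg, ha] at e2
  rw [ha] at e1
  simp only [Finset.sum_range_succ, Finset.sum_range_zero, Nat.factorial] at e1 e2
  norm_num at e1 e2
  rw [abs_le] at e1 e2 ⊢
  rw [sinh_eq]
  constructor <;> nlinarith [e1.1, e1.2, e2.1, e2.2]

lemma cube_div_le_sinh {t : ℝ} (h0 : 0 ≤ t) : t ^ 3 / 12 ≤ sinh t := by
  have h1 := Real.sum_le_exp_of_nonneg h0 4
  have h2 : exp (-t) ≤ 1 := by simpa using h0
  simp only [Finset.sum_range_succ, Finset.sum_range_zero, Nat.factorial] at h1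
  norm_num at h1
  rw [sinh_eq]
  nlinarith [sq_nonneg t]

lemma abs_cschRemainder_le {t : ℝ} (h0 : 0 ≤ t) : |cschRemainder t| ≤ t := by
  rcases h0.eq_or_lt with rfl | h0
  · simp [cschRemainder]
  have hs : t < sinh t := self_lt_sinh_iff.mpr h0
  have hs0 : 0 < sinh t := h0.trans hs
  have e : cschRemainder t = -((sinh t - t) / (2 * t * sinh t)) := by
    unfold cschRemainder; field_simp; ring
  rw [e, abs_neg, abs_of_nonneg (div_nonneg (by linarith) (by positivity)),
    div_le_iff₀ (by positivity)]
  rcases le_total t 1 with h1 | h1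
  · have := (abs_le.mp (abs_sinh_sub_le h0.le h1)).2
    have h5 : t ^ 5 ≤ t ^ 3 := pow_le_pow_of_le_one h0.le h1 (by norm_num)
    nlinarith [mul_le_mul_of_nonneg_left hs.le (sq_nonneg t)]
  · have : 1 ≤ t * t := by nlinarith
    nlinarith

lemma abs_cschRemainder_le_inv {t : ℝ} (h0 : 0 < t) : |cschRemainder t| ≤ t⁻¹ := by
  have hs : t < sinh t := self_lt_sinh_iff.mpr h0
  have h1 : (sinh t)⁻¹ ≤ t⁻¹ := inv_anti₀ h0 hs.le
  have h2 : 0 < (sinh t)⁻¹ := inv_pos.mpr (h0.trans hs)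
  have h3 : 0 < t⁻¹ := inv_pos.mpr h0
  unfold cschRemainder
  rw [abs_le]; constructor <;> linarith

lemma hasDerivAt_cschRemainder {t : ℝ} (h0 : 0 < t) :
    HasDerivAt cschRemainder ((-cosh t / sinh t ^ 2 + 1 / t ^ 2) / 2) t := by
  have hs0 : sinh t ≠ 0 := (sinh_pos_iff.mpr h0).ne'
  have := (((hasDerivAt_sinh t).inv hs0).sub (hasDerivAt_inv h0.ne')).div_const 2
  refine this.congr_deriv ?_
  congr 1; field_simp; ring

lemma hasDerivAt_deriv_cschRemainder {t : ℝ} (h0 : 0 < t) :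
    HasDerivAt (fun t ↦ (-cosh t / sinh t ^ 2 + 1 / t ^ 2) / 2)
      ((2 / sinh t ^ 3 + 1 / sinh t - 2 / t ^ 3) / 2) t := by
  have hs0 : sinh t ≠ 0 := (sinh_pos_iff.mpr h0).ne'
  have h1 := (hasDerivAt_cosh t).neg.div ((hasDerivAt_sinh t).pow 2) (pow_ne_zero 2 hs0)
  have h2 := ((hasDerivAt_id t).pow 2).inv (pow_ne_zero 2 h0.ne')
  have := (h1.add h2).div_const 2
  refine (this.congr_of_eventuallyEq (.of_forall fun x ↦ by simp [one_div])).congr_deriv ?_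
  congr 1
  simp only [Pi.pow_apply, id]
  field_simp
  have := Real.cosh_sq t
  simp
  linear_combination (2 * sinh t * t ^ 4) * this

set_option maxHeartbeats 1000000 in
lemma abs_deriv_deriv_cschRemainder_le {t : ℝ} (h0 : 0 < t) :
    |(2 / sinh t ^ 3 + 1 / sinh t - 2 / t ^ 3) / 2| ≤ 24 / (1 + t) ^ 2 := by
  have hs : t < sinh t := self_lt_sinh_iff.mpr h0
  have hs0 : 0 < sinh t := h0.trans hs
  have hs3 : t ^ 3 ≤ sinh t ^ 3 := by gcongr
  rcases le_total t 1 with h1 | h1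
  · have hb := abs_le.mp (abs_sinh_sub_le h0.le h1)
    obtain ⟨v, hv⟩ : ∃ v, sinh t = t * (1 + v) := ⟨sinh t / t - 1, by field_simp; ring⟩
    have hv1 : v ≤ t ^ 2 / 6 + t ^ 4 / 100 := by
      have : t * v ≤ t * (t ^ 2 / 6 + t ^ 4 / 100) := by rw [hv] at hb; nlinarith [hb.2]
      exact le_of_mul_le_mul_left this h0
    have hv2 : t ^ 2 / 6 - t ^ 4 / 100 ≤ v := by
      have : t * (t ^ 2 / 6 - t ^ 4 / 100) ≤ t * v := by rw [hv] at hb; nlinarith [hb.1]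
      exact le_of_mul_le_mul_left this h0
    have ht2 : t ^ 2 ≤ 1 := by nlinarith
    have ht4 : t ^ 4 ≤ t ^ 2 := pow_le_pow_of_le_one h0.le h1 (by norm_num)
    have ht43 : t ^ 4 ≤ t ^ 3 := pow_le_pow_of_le_one h0.le h1 (by norm_num)
    have hv0 : 0 ≤ v := by nlinarith [sq_nonneg t]
    have hvt : v ≤ t ^ 2 := by nlinarith [sq_nonneg t]
    have hvv : v ^ 2 ≤ t ^ 4 := (pow_le_pow_left₀ hv0 hvt 2).trans_eq (by ring)
    have hv3 : v ^ 3 ≤ t ^ 4 := (pow_le_pow_of_le_one hv0 (hvt.trans ht2) (by norm_num)).trans hvv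
    have hv3' : 0 ≤ v ^ 3 := by positivity
    have hvt2 : v * t ^ 2 ≤ t ^ 4 :=
      (mul_le_mul_of_nonneg_right hvt (sq_nonneg t)).trans_eq (by ring)
    have hvt2' : v ^ 2 * t ^ 2 ≤ t ^ 4 := (mul_le_of_le_one_right (sq_nonneg v) ht2).trans hvv
    have e : (2 / sinh t ^ 3 + 1 / sinh t - 2 / t ^ 3) / 2 =
        ((1 + v) ^ 2 * t ^ 2 - 2 * ((1 + v) ^ 3 - 1)) / (2 * t ^ 3 * (1 + v) ^ 3) := by
      rw [hv]; field_simp; ring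
    have hnum : |(1 + v) ^ 2 * t ^ 2 - 2 * ((1 + v) ^ 3 - 1)| ≤ 12 * t ^ 3 := by
      have h6 : |6 * v - t ^ 2| ≤ t ^ 4 := by
        rw [abs_le]; constructor <;> nlinarith [pow_nonneg h0.le 4]
      have h7 := mul_nonneg hv0 (sq_nonneg t)
      have h8 := mul_nonneg (sq_nonneg v) (sq_nonneg t)
      have h9 := sq_nonneg v
      have h10 : 0 ≤ t ^ 4 := by positivity
      rw [show (1 + v) ^ 2 * t ^ 2 - 2 * ((1 + v) ^ 3 - 1) = -(6 * v - t ^ 2) + 2 * (v * t ^ 2)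
        + v ^ 2 * t ^ 2 - 6 * v ^ 2 - 2 * v ^ 3 by ring]
      rw [abs_le] at h6 ⊢
      constructor <;> linarith [h6.1, h6.2]
    have hden : t ^ 3 * 2 ≤ 2 * t ^ 3 * (1 + v) ^ 3 := by
      have : 1 ≤ (1 + v) ^ 3 := one_le_pow₀ (by linarith)
      nlinarith [pow_pos h0 3]
    rw [e, abs_div, abs_of_pos (by positivity : 0 < 2 * t ^ 3 * (1 + v) ^ 3)]
    calc _ ≤ (12 * t ^ 3) / (t ^ 3 * 2) := by gcongr
      _ = 6 := by field_simp; norm_num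
      _ ≤ _ := by rw [le_div_iff₀ (by positivity)]; nlinarith
  · have h2 : 1 / sinh t ≤ 12 / t ^ 3 := by
      rw [div_le_div_iff₀ hs0 (by positivity)]
      linarith [cube_div_le_sinh h0.le]
    have h3 : 2 / sinh t ^ 3 ≤ 2 / t ^ 3 := by gcongr
    have h4 : 0 < 2 / sinh t ^ 3 := by positivity
    have h5 : 0 < 1 / sinh t := by positivity
    have h6 : 2 / t ^ 3 ≤ 12 / t ^ 3 := by gcongr; norm_num
    have h7 : 12 / t ^ 3 / 2 ≤ 24 / (1 + t) ^ 2 := by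
      rw [div_div, div_le_div_iff₀ (by positivity) (by positivity)]
      nlinarith [mul_nonneg (sub_nonneg.mpr h1) (sq_nonneg t), sq_nonneg (t - 1)]
    refine le_trans ?_ h7
    rw [abs_le]; constructor <;> linarith

lemma continuousOn_cschRemainder : ContinuousOn cschRemainder (Ici 0) := by
  intro t ht
  rcases (show 0 ≤ t from ht).eq_or_lt with rfl | h0
  · have : cschRemainder 0 = 0 := by simp [cschRemainder]
    rw [ContinuousWithinAt, this]
    refine squeeze_zero_norm' (a := fun t ↦ t) ?_ (tendsto_id'.mpr nhdsWithin_le_nhds)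
    filter_upwards [self_mem_nhdsWithin] with t ht
    exact abs_cschRemainder_le ht
  · exact (hasDerivAt_cschRemainder h0).continuousAt.continuousWithinAt

lemma abs_second_difference_cschRemainder_le {t δ : ℝ} (h0 : 0 ≤ t) (hδ : 0 < δ) :
    |cschRemainder (t + 2 * δ) - 2 * cschRemainder (t + δ) + cschRemainder t|
      ≤ 24 / (1 + t) ^ 2 * δ ^ 2 := by
  have hder : ∀ u ∈ Ioo t (t + δ), HasDerivAt
      (fun u ↦ cschRemainder (u + δ) - cschRemainder u)
      ((-cosh (u + δ) / sinh (u + δ) ^ 2 + 1 / (u + δ) ^ 2) / 2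
        - (-cosh u / sinh u ^ 2 + 1 / u ^ 2) / 2) u := by
    intro u hu
    have hu0 : 0 < u := h0.trans_lt hu.1
    exact ((hasDerivAt_cschRemainder (by linarith : 0 < u + δ)).comp_add_const u δ).sub
      (hasDerivAt_cschRemainder hu0)
  have hcont : ContinuousOn (fun u ↦ cschRemainder (u + δ) - cschRemainder u)
      (Icc t (t + δ)) := by
    refine ContinuousOn.sub ?_ (continuousOn_cschRemainder.mono fun u hu ↦ h0.trans hu.1)
    refine continuousOn_cschRemainder.comp (by fun_prop) fun u hu ↦ ?_
    have := hu.1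
    show 0 ≤ u + δ
    linarith
  obtain ⟨u, hu, he⟩ := exists_hasDerivAt_eq_slope _ _ (by linarith) hcont hder
  have hu0 : 0 < u := h0.trans_lt hu.1
  obtain ⟨v, hv, he'⟩ := exists_hasDerivAt_eq_slope
    (fun t ↦ (-cosh t / sinh t ^ 2 + 1 / t ^ 2) / 2) _ (show u < u + δ by linarith)
    (fun x hx ↦ (hasDerivAt_deriv_cschRemainder
      (hu0.trans_le hx.1)).continuousAt.continuousWithinAt)
    (fun x hx ↦ hasDerivAt_deriv_cschRemainder (hu0.trans hx.1))
  have hv0 : 0 < v := hu0.trans hv.1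
  have hb := abs_deriv_deriv_cschRemainder_le hv0
  rw [he'] at hb
  rw [add_sub_cancel_left] at he hb
  rw [he] at hb
  rw [div_div, abs_div, div_le_iff₀ (by positivity), abs_of_pos (by positivity : 0 < δ * δ)] at hb
  calc _ = |cschRemainder (t + δ + δ) - cschRemainder (t + δ) -
        (cschRemainder (t + δ) - cschRemainder t)| := by
        rw [show t + 2 * δ = t + δ + δ by ring]; congr 1; ring
    _ ≤ _ := hb
    _ ≤ 24 / (1 + t) ^ 2 * (δ * δ) := by
        have : t ≤ v := hu.1.le.trans hv.1.le
        gcongr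
    _ = _ := by ring

end

section

open Complex Set Filter Topology ZMod

lemma one_sub_mul_sum_pow_mul (z : ℂ) (a : ℕ → ℂ) (N : ℕ) :
    (1 - z) * ∑ d ∈ Finset.range N, z ^ d * a d =
      a 0 - z ^ N * a N + ∑ d ∈ Finset.range N, z ^ (d + 1) * (a (d + 1) - a d) := by
  induction N with
  | zero => simp
  | succ N ih =>
    rw [Finset.sum_range_succ, mul_add, ih, Finset.sum_range_succ]
    ring

lemma norm_sum_pow_mul_le {z : ℂ} (hz : ‖z‖ = 1) (hz1 : z ≠ 1) {a : ℕ → ℂ} (h0 : a 0 = 0)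
    {E : ℕ → ℝ} {T : ℝ} (hE : ∀ d, ‖a (d + 2) - 2 * a (d + 1) + a d‖ ≤ E d) (N : ℕ)
    (hT : ∑ d ∈ Finset.range N, E d ≤ T) :
    ‖∑ d ∈ Finset.range N, z ^ d * a d‖ ≤
      (‖a 1‖ + T + 3 * ‖a N‖ + ‖a (N + 1)‖) * (‖1 - z‖ ^ 2)⁻¹ := by
  have hz1' : 0 < ‖1 - z‖ := norm_pos_iff.mpr (sub_ne_zero.mpr hz1.symm)
  have h2 : ‖1 - z‖ ≤ 2 := (norm_sub_le _ _).trans (by rw [hz]; norm_num)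
  have e : (1 - z) ^ 2 * ∑ d ∈ Finset.range N, z ^ d * a d =
      -((1 - z) * (z ^ N * a N)) + z * (a 1 - z ^ N * (a (N + 1) - a N) +
        ∑ d ∈ Finset.range N, z ^ (d + 1) * (a (d + 2) - 2 * a (d + 1) + a d)) := by
    have h3 := one_sub_mul_sum_pow_mul z (fun d ↦ a (d + 1) - a d) N
    have h4 : ∑ d ∈ Finset.range N, z ^ (d + 1) * (a (d + 1) - a d) =
        z * ∑ d ∈ Finset.range N, z ^ d * (a (d + 1) - a d) := by
      rw [Finset.mul_sum]; exact Finset.sum_congr rfl fun d _ ↦ by ring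
    have h5 : ∑ d ∈ Finset.range N, z ^ (d + 1) * (a (d + 2) - 2 * a (d + 1) + a d) =
        ∑ d ∈ Finset.range N, z ^ (d + 1) * (a (d + 1 + 1) - a (d + 1) - (a (d + 1) - a d)) :=
      Finset.sum_congr rfl fun d _ ↦ by rw [show d + 1 + 1 = d + 2 from rfl]; ring
    rw [pow_two, mul_assoc, one_sub_mul_sum_pow_mul, h4, h0, mul_add, mul_left_comm, h3, h5, h0]
    simp only [zero_add]
    ring
  rw [← div_eq_mul_inv, le_div_iff₀ (by positivity), mul_comm, ← norm_pow, ← norm_mul, e]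
  have hs : ‖∑ d ∈ Finset.range N, z ^ (d + 1) * (a (d + 2) - 2 * a (d + 1) + a d)‖ ≤ T := by
    refine (norm_sum_le_of_le _ fun d _ ↦ ?_).trans hT
    rw [norm_mul, norm_pow, hz, one_pow, one_mul]
    exact hE d
  refine (norm_add_le _ _).trans ?_
  rw [norm_neg, norm_mul, norm_mul, norm_mul, norm_pow, hz, one_pow, one_mul, one_mul]
  have h6 : ‖a 1 - z ^ N * (a (N + 1) - a N)‖ ≤ ‖a 1‖ + (‖a (N + 1)‖ + ‖a N‖) := by
    refine (norm_sub_le _ _).trans ?_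
    rw [norm_mul, norm_pow, hz, one_pow, one_mul]
    gcongr
    exact norm_sub_le _ _
  have h7 := mul_le_mul_of_nonneg_right h2 (norm_nonneg (a N))
  have h8 := norm_add_le (a 1 - z ^ N * (a (N + 1) - a N))
    (∑ d ∈ Finset.range N, z ^ (d + 1) * (a (d + 2) - 2 * a (d + 1) + a d))
  linarith

lemma inv_norm_one_sub_stdAddChar_sq_le {q : ℕ} [NeZero q] {a : ZMod q} (ha : a ≠ 0) :
    (‖1 - stdAddChar a‖ ^ 2)⁻¹ ≤
      (q : ℝ) ^ 2 / 16 * (((a.val : ℝ) ^ 2)⁻¹ + (((q - a.val : ℕ) : ℝ) ^ 2)⁻¹) := by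
  have hq : (0 : ℝ) < q := by exact_mod_cast Nat.pos_of_neZero q
  have hv : a.val < q := ZMod.val_lt a
  have hv0 : 0 < a.val := Nat.pos_of_ne_zero ((ZMod.val_ne_zero a).mpr ha)
  have hw0 : 0 < q - a.val := Nat.sub_pos_of_lt hv
  set v := a.val with hvdef
  have hv0' : (0 : ℝ) < v := by exact_mod_cast hv0
  have hw0' : (0 : ℝ) < ((q - v : ℕ) : ℝ) := by exact_mod_cast hw0
  have hw : ((q - v : ℕ) : ℝ) = q - v := by push_cast [hv.le]; rfl
  have e : ‖1 - stdAddChar a‖ = 2 * |Real.sin (Real.pi * v / q)| := by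
    rw [norm_sub_rev, stdAddChar_apply, toCircle_apply, ← hvdef]
    have := norm_exp_I_mul_ofReal_sub_one (2 * Real.pi * v / q)
    rw [show 2 * Real.pi * v / q / 2 = Real.pi * v / q by ring, norm_mul] at this
    simp only [Real.norm_eq_abs, abs_two] at this
    rw [← this]
    congr 3; push_cast; ring
  have hpi := Real.pi_pos
  rcases le_total (2 * v) q with h | h
  · have h1 : 2 / Real.pi * (Real.pi * v / q) ≤ Real.sin (Real.pi * v / q) := by
      refine Real.mul_le_sin (by positivity) ?_
      have : (2 * v : ℝ) ≤ q := by exact_mod_cast h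
      rw [div_le_div_iff₀ hq two_pos]; nlinarith
    have h2 : 4 * v / q ≤ ‖1 - stdAddChar a‖ := by
      rw [e]
      have : 2 / Real.pi * (Real.pi * v / q) = 2 * v / q := by field_simp
      have := le_abs_self (Real.sin (Real.pi * v / q))
      have : 4 * v / q = 2 * (2 * v / q : ℝ) := by ring
      linarith
    calc (‖1 - stdAddChar a‖ ^ 2)⁻¹ ≤ ((4 * v / q : ℝ) ^ 2)⁻¹ := by gcongr
      _ = (q : ℝ) ^ 2 / 16 * ((v : ℝ) ^ 2)⁻¹ := by field_simp; norm_num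
      _ ≤ _ := by
        gcongr
        exact le_add_of_nonneg_right (by positivity)
  · have hle : (2 : ℝ) * (q - v) ≤ q := by
      have : (q : ℝ) ≤ 2 * v := by exact_mod_cast h
      linarith
    have h1 : 2 / Real.pi * (Real.pi * (q - v) / q) ≤ Real.sin (Real.pi * (q - v) / q) := by
      rw [hw] at hw0'
      refine Real.mul_le_sin (by positivity) ?_
      rw [div_le_div_iff₀ hq two_pos]; nlinarith
    have h2 : 4 * ((q - v : ℕ) : ℝ) / q ≤ ‖1 - stdAddChar a‖ := by
      rw [e, hw]
      have h3 : Real.sin (Real.pi * (q - v) / q) = Real.sin (Real.pi * v / q) := by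
        rw [show Real.pi * (q - v) / q = Real.pi - Real.pi * v / q by field_simp, Real.sin_pi_sub]
      have : 2 / Real.pi * (Real.pi * (q - v) / q) = 2 * (q - v) / q := by field_simp
      have := le_abs_self (Real.sin (Real.pi * v / q))
      have : 4 * (q - v) / q = 2 * (2 * (q - v) / q : ℝ) := by ring
      linarith
    calc (‖1 - stdAddChar a‖ ^ 2)⁻¹ ≤ ((4 * ((q - v : ℕ) : ℝ) / q : ℝ) ^ 2)⁻¹ := by gcongr
      _ = (q : ℝ) ^ 2 / 16 * (((q - v : ℕ) : ℝ) ^ 2)⁻¹ := by field_simp; norm_num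
      _ ≤ _ := by
        gcongr
        exact le_add_of_nonneg_left (by positivity)

lemma sum_inv_norm_one_sub_stdAddChar_sq_le (q : ℕ) [NeZero q] :
    ∑ a ∈ Finset.univ.erase (0 : ZMod q), (‖1 - stdAddChar a‖ ^ 2)⁻¹ ≤ (q : ℝ) ^ 2 / 4 := by
  have h1 : ∑ a ∈ Finset.univ.erase (0 : ZMod q), ((a.val : ℝ) ^ 2)⁻¹ =
      ∑ v ∈ Finset.Ioo 0 q, ((v : ℝ) ^ 2)⁻¹ := by
    refine Finset.sum_nbij' (fun a ↦ a.val) (fun v ↦ (v : ZMod q)) ?_ ?_ ?_ ?_ ?_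
    · intro a ha
      have ha := Finset.ne_of_mem_erase ha
      simp [ZMod.val_lt a, Nat.pos_iff_ne_zero, ha]
    · intro v hv
      rw [Finset.mem_Ioo] at hv
      simp only [Finset.mem_erase, Finset.mem_univ, and_true]
      rw [Ne, ZMod.natCast_eq_zero_iff]
      exact fun h ↦ absurd (Nat.le_of_dvd hv.1 h) (by omega)
    · intro a _; simp
    · intro v hv; exact ZMod.val_cast_of_lt (Finset.mem_Ioo.mp hv).2
    · intro a _; rfl
  have h2 : ∑ a ∈ Finset.univ.erase (0 : ZMod q), (((q - a.val : ℕ) : ℝ) ^ 2)⁻¹ =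
      ∑ a ∈ Finset.univ.erase (0 : ZMod q), ((a.val : ℝ) ^ 2)⁻¹ := by
    refine Finset.sum_nbij' (fun a ↦ -a) (fun a ↦ -a) ?_ ?_ ?_ ?_ ?_
    · intro a ha; simpa using ha
    · intro a ha; simpa using ha
    · intro a _; simp
    · intro a _; simp
    · intro a ha
      have : NeZero a := ⟨Finset.ne_of_mem_erase ha⟩
      rw [ZMod.val_neg_of_ne_zero]
  have h3 := sum_Ioo_inv_sq_le (α := ℝ) 0 q
  calc _ ≤ ∑ a ∈ Finset.univ.erase (0 : ZMod q),
        (q : ℝ) ^ 2 / 16 * (((a.val : ℝ) ^ 2)⁻¹ + (((q - a.val : ℕ) : ℝ) ^ 2)⁻¹) :=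
        Finset.sum_le_sum fun a ha ↦ inv_norm_one_sub_stdAddChar_sq_le (Finset.ne_of_mem_erase ha)
    _ ≤ (q : ℝ) ^ 2 / 16 * (2 + 2) := by
        rw [← Finset.mul_sum, Finset.sum_add_distrib, h2, h1]
        norm_num at h3
        gcongr
    _ = _ := by ring

namespace DirichletCharacter

variable {q : ℕ} [NeZero q]

lemma norm_gaussSum_of_quadratic {χ : DirichletCharacter ℂ q} (hχ : χ.IsPrimitive)
    (h2 : χ ^ 2 = 1) : ‖gaussSum χ stdAddChar‖ = Real.sqrt q := by
  have hinv : χ⁻¹ = χ := by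
    rw [inv_eq_iff_mul_eq_one, ← pow_two, h2]
  have hF : ZMod.dft χ = fun k ↦ χ (-k) * gaussSum χ stdAddChar := by
    ext k
    rw [hχ.fourierTransform_eq_inv_mul_gaussSum, hinv]
  have h3 := congr_fun (dft_dft (χ : ZMod q → ℂ)) (-1)
  rw [hF, dft_mul_const, dft_comp_neg, hF] at h3
  simp only [neg_neg, map_one, smul_eq_mul, mul_one] at h3
  have h4 : ‖gaussSum χ stdAddChar‖ ^ 2 = q := by
    have := congrArg norm h3
    have hneg : ‖χ (-1)‖ = 1 := by simpa using χ.unit_norm_eq_one (-1)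
    rwa [norm_mul, norm_mul, hneg, one_mul, ← pow_two, Complex.norm_natCast] at this
  rw [← h4, Real.sqrt_sq (norm_nonneg _)]

lemma norm_sum_mul_le {χ : DirichletCharacter ℂ q} (hχ : χ.IsPrimitive) (hχ1 : χ ≠ 1)
    (h2 : χ ^ 2 = 1) {a : ℕ → ℂ} (h0 : a 0 = 0)
    {E : ℕ → ℝ} {T : ℝ} (hE : ∀ d, ‖a (d + 2) - 2 * a (d + 1) + a d‖ ≤ E d) (N : ℕ)
    (hT : ∑ d ∈ Finset.range N, E d ≤ T) :
    ‖∑ d ∈ Finset.range N, χ d * a d‖ ≤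
      (‖a 1‖ + T + 3 * ‖a N‖ + ‖a (N + 1)‖) * ((q : ℝ) ^ 2 / (4 * Real.sqrt q)) := by
  have hq : (0 : ℝ) < q := by exact_mod_cast Nat.pos_of_neZero q
  have hinv : χ⁻¹ = χ := by
    rw [inv_eq_iff_mul_eq_one, ← pow_two, h2]
  have hq1 : q ≠ 1 := by
    rintro rfl
    exact hχ1 (level_one χ)
  have hχ0 : χ 0 = 0 := by
    have : Nontrivial (ZMod q) := ZMod.nontrivial_iff.mpr hq1
    exact MulChar.map_zero χ
  have hτ := norm_gaussSum_of_quadratic hχ h2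
  have hT0 : 0 ≤ T := le_trans (Finset.sum_nonneg fun d _ ↦ (norm_nonneg _).trans (hE d)) hT
  have key : gaussSum χ stdAddChar * ∑ d ∈ Finset.range N, χ d * a d =
      ∑ b ∈ Finset.univ.erase (0 : ZMod q),
        χ b * ∑ d ∈ Finset.range N, stdAddChar b ^ d * a d := by
    rw [Finset.sum_erase _ (by rw [hχ0, zero_mul])]
    simp_rw [Finset.mul_sum]
    rw [Finset.sum_comm]
    refine Finset.sum_congr rfl fun d _ ↦ ?_
    have h3 := gaussSum_mulShift_of_isPrimitive stdAddChar hχ (d : ZMod q)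
    rw [hinv] at h3
    rw [← mul_assoc, mul_comm (gaussSum _ _), ← h3, gaussSum, Finset.sum_mul]
    refine Finset.sum_congr rfl fun b _ ↦ ?_
    rw [AddChar.mulShift_apply, ← nsmul_eq_mul, AddChar.map_nsmul_eq_pow, mul_assoc]
  have hb : ‖∑ b ∈ Finset.univ.erase (0 : ZMod q),
        χ b * ∑ d ∈ Finset.range N, stdAddChar b ^ d * a d‖ ≤
      (‖a 1‖ + T + 3 * ‖a N‖ + ‖a (N + 1)‖) * ((q : ℝ) ^ 2 / 4) := by
    refine (norm_sum_le_of_le (n := fun b ↦ (‖a 1‖ + T + 3 * ‖a N‖ + ‖a (N + 1)‖) *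
      (‖1 - stdAddChar b‖ ^ 2)⁻¹) _ fun b hb ↦ ?_).trans ?_
    · rw [norm_mul]
      refine (mul_le_of_le_one_left (norm_nonneg _) (χ.norm_le_one b)).trans ?_
      have hb1 : (stdAddChar b : ℂ) ≠ 1 := by
        intro h
        have : (stdAddChar b : ℂ) = stdAddChar (0 : ZMod q) := by rw [h, AddChar.map_zero_eq_one]
        exact Finset.ne_of_mem_erase hb (injective_stdAddChar this)
      have hb2 : ‖(stdAddChar b : ℂ)‖ = 1 := by
        rw [stdAddChar_apply]; exact Circle.norm_coe _
      exact norm_sum_pow_mul_le hb2 hb1 h0 hE N hT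
    · rw [← Finset.mul_sum]
      gcongr
      exact sum_inv_norm_one_sub_stdAddChar_sq_le q
  rw [← key, norm_mul, hτ] at hb
  have hs : 0 < Real.sqrt q := Real.sqrt_pos.mpr hq
  have : ‖∑ d ∈ Finset.range N, χ d * a d‖ ≤
      (‖a 1‖ + T + 3 * ‖a N‖ + ‖a (N + 1)‖) * ((q : ℝ) ^ 2 / 4) / Real.sqrt q := by
    rw [le_div_iff₀ hs, mul_comm]; exact hb
  refine this.trans_eq ?_
  field_simp

end DirichletCharacter

end

section

open Complex Set Filter Topology
open scoped ComplexOrder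

namespace DirichletCharacter

variable {q : ℕ}

lemma one_le_zetaMul_prime_pow_sq {n : ℕ} {χ : DirichletCharacter ℂ n} (hχ : χ ^ 2 = 1)
    {p : ℕ} (hp : p.Prime) (k : ℕ) : 1 ≤ zetaMul χ (p ^ (2 * k)) := by
  have e : zetaMul χ (p ^ (2 * k)) = ∑ i ∈ Finset.range (2 * k + 1), χ p ^ i := by
    rw [zetaMul, ArithmeticFunction.coe_zeta_mul_apply, Nat.sum_divisors_prime_pow hp]
    refine Finset.sum_congr rfl fun i _ ↦ ?_
    rw [← apply_eq_toArithmeticFunction_apply χ (pow_ne_zero i hp.ne_zero)]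
    push_cast
    rw [map_pow]
  rw [e]
  rcases MulChar.isQuadratic_iff_sq_eq_one.mpr hχ p with h | h | h
  · rw [h, Finset.sum_range_succ']; simp
  · rw [h]; simp only [one_pow, Finset.sum_const, Finset.card_range, nsmul_eq_mul, mul_one]
    exact_mod_cast Nat.le_add_left 1 (2 * k)
  · rw [h, neg_one_geom_sum]
    simp

lemma one_le_zetaMul_sq {χ : DirichletCharacter ℂ q} (hχ : χ ^ 2 = 1) {m : ℕ} (hm : m ≠ 0) :
    1 ≤ zetaMul χ (m ^ 2) := by
  rw [χ.isMultiplicative_zetaMul.multiplicative_factorization _ (pow_ne_zero 2 hm),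
    Finsupp.prod]
  rw [← Finset.prod_const_one (s := (m ^ 2).factorization.support)]
  refine Finset.prod_le_prod (fun _ _ ↦ zero_le_one) fun p hp ↦ ?_
  rw [Nat.factorization_pow]
  exact one_le_zetaMul_prime_pow_sq hχ (Nat.prime_of_mem_primeFactors hp) _

/-- The weight `e ^ (-u) - e ^ (-2 u)`. -/
noncomputable def expWeight (u : ℝ) : ℝ := Real.exp (-u) - Real.exp (-(2 * u))

lemma expWeight_nonneg {u : ℝ} (hu : 0 ≤ u) : 0 ≤ expWeight u := by
  rw [expWeight, sub_nonneg]
  exact Real.exp_le_exp.mpr (by linarith)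

lemma expWeight_le (u : ℝ) : expWeight u ≤ Real.exp (-u) := by
  rw [expWeight]; linarith [Real.exp_pos (-(2 * u))]

lemma one_div_sixteen_le_expWeight {u : ℝ} (h1 : 1 / 4 ≤ u) (h2 : u ≤ 1) :
    1 / 16 ≤ expWeight u := by
  have e : expWeight u = Real.exp (-u) * (1 - Real.exp (-u)) := by
    rw [expWeight, mul_sub, mul_one, ← Real.exp_add]; congr 2; ring
  have h3 : 1 / 3 ≤ Real.exp (-u) := by
    have h4 : Real.exp (-1) ≤ Real.exp (-u) := Real.exp_le_exp.mpr (by linarith)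
    refine le_trans ?_ h4
    rw [Real.exp_neg, one_div]
    exact inv_anti₀ (Real.exp_pos 1) (Real.exp_one_lt_d9.le.trans (by norm_num))
  have h5 : Real.exp (-u) ≤ 4 / 5 := by
    have h6 : u + 1 ≤ Real.exp u := Real.add_one_le_exp u
    rw [Real.exp_neg]
    exact (inv_anti₀ (by linarith) h6).trans ((inv_anti₀ (by norm_num)
      (show (5 / 4 : ℝ) ≤ u + 1 by linarith)).trans (by norm_num))
  rw [e]
  nlinarith

lemma hasSum_expWeight_mul {t : ℝ} (ht : 0 < t) :
    HasSum (fun m : ℕ ↦ expWeight (t * (m + 1))) (2 * Real.sinh t)⁻¹ := by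
  have g (s : ℝ) (hs : 0 < s) : HasSum (fun m : ℕ ↦ Real.exp (-(s * (m + 1))))
      (Real.exp (-s) * (1 - Real.exp (-s))⁻¹) := by
    have := (hasSum_geometric_of_lt_one (Real.exp_pos (-s)).le
      (by simpa using hs)).mul_left (Real.exp (-s))
    refine this.congr_fun fun m ↦ ?_
    rw [← Real.exp_nat_mul, ← Real.exp_add]; congr 1; ring
  have h := (g t ht).sub (g (2 * t) (by linarith))
  have e : Real.exp (-t) * (1 - Real.exp (-t))⁻¹ -
      Real.exp (-(2 * t)) * (1 - Real.exp (-(2 * t)))⁻¹ = (2 * Real.sinh t)⁻¹ := by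
    have hy : Real.exp (-(2 * t)) = Real.exp (-t) ^ 2 := by
      rw [← Real.exp_nat_mul]; congr 1; push_cast; ring
    have hy1 : Real.exp (-t) < 1 := by simpa using ht
    have hy0 := Real.exp_pos (-t)
    have hs : 2 * Real.sinh t = (Real.exp (-t))⁻¹ - Real.exp (-t) := by
      rw [Real.sinh_eq, ← Real.exp_neg, neg_neg]; ring
    rw [hy, hs]
    set y := Real.exp (-t)
    have h1 : 1 - y ≠ 0 := by linarith
    have h2 : 1 + y ≠ 0 := by linarith
    have h3 : 1 - y ^ 2 ≠ 0 := by
      rw [show 1 - y ^ 2 = (1 - y) * (1 + y) by ring]; exact mul_ne_zero h1 h2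
    have h4 : y⁻¹ - y ≠ 0 := by
      rw [show y⁻¹ - y = (1 - y ^ 2) / y by field_simp]; exact div_ne_zero h3 hy0.ne'
    rw [show y⁻¹ - y = (1 - y ^ 2) / y by field_simp]
    field_simp
    ring
  rw [e] at h
  refine h.congr_fun fun m ↦ ?_
  rw [expWeight]; congr 2; ring_nf

lemma summable_mul_expWeight {n : ℕ} (χ : DirichletCharacter ℂ n) {x : ℝ} (hx : 0 < x) :
    Summable fun p : ℕ+ × ℕ+ ↦ χ ((p.1 : ℕ) : ZMod n) * (expWeight (p.1 * p.2 / x) : ℂ) := by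
  have hs : Summable fun n : ℕ+ ↦ Real.exp (-(n / x)) := by
    have h1 : Summable fun n : ℕ ↦ Real.exp (-(n / x)) := by
      have := Real.summable_exp_nat_mul_iff.mpr (show -(1 / x) < 0 by simpa using hx)
      refine this.congr fun n ↦ ?_
      congr 1; ring
    exact h1.comp_injective PNat.coe_injective
  have hs2 := ((hs.mul_of_nonneg hs (fun _ ↦ (Real.exp_pos _).le)
    (fun _ ↦ (Real.exp_pos _).le))).mul_left (Real.exp (1 / x))
  refine Summable.of_norm_bounded hs2 fun p ↦ ?_
  rw [norm_mul]
  refine (mul_le_of_le_one_left (norm_nonneg _) (χ.norm_le_one _)).trans ?_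
  have hp1 : (1 : ℝ) ≤ p.1 := by exact_mod_cast p.1.pos
  have hp2 : (1 : ℝ) ≤ p.2 := by exact_mod_cast p.2.pos
  rw [norm_real, Real.norm_of_nonneg (expWeight_nonneg (by positivity))]
  refine (expWeight_le _).trans ?_
  rw [← Real.exp_add, ← Real.exp_add, Real.exp_le_exp]
  have : (p.1 + p.2 - 1 : ℝ) / x ≤ p.1 * p.2 / x := by
    gcongr; nlinarith
  have e : (1 / x + (-(p.1 / x) + -(p.2 / x)) : ℝ) = -((p.1 + p.2 - 1 : ℝ) / x) := by ring
  rw [e]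
  linarith

lemma tendsto_sum_inv_sinh (χ : DirichletCharacter ℂ q) {x : ℝ} (hx : 0 < x) :
    Tendsto (fun N : ℕ ↦ ∑ d ∈ Finset.range N,
        χ ((d + 1 : ℕ) : ZMod q) * ((2 * Real.sinh ((d + 1 : ℕ) / x))⁻¹ : ℝ)) atTop
      (𝓝 (∑' p : ℕ+ × ℕ+, χ ((p.1 : ℕ) : ZMod q) * (expWeight (p.1 * p.2 / x) : ℂ))) := by
  have h := (summable_mul_expWeight χ hx).hasSum.prod_fiberwise
    (g := fun d : ℕ+ ↦ χ ((d : ℕ) : ZMod q) * ((2 * Real.sinh (d / x))⁻¹ : ℝ)) fun d ↦ by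
      have hd : (0 : ℝ) < d / x := div_pos (by exact_mod_cast d.pos) hx
      have h1 := (hasSum_ofReal.mpr (hasSum_expWeight_mul hd)).mul_left (χ ((d : ℕ) : ZMod q))
      rw [← Equiv.pnatEquivNat.symm.hasSum_iff]
      refine h1.congr_fun fun m ↦ ?_
      simp only [Function.comp_apply, Equiv.pnatEquivNat_symm_apply]
      congr 3
      simp
      ring
  rw [← Equiv.pnatEquivNat.symm.hasSum_iff] at h
  refine h.tendsto_sum_nat.congr fun N ↦ ?_
  refine Finset.sum_congr rfl fun d _ ↦ ?_
  simp

lemma tsum_mul_expWeight_eq (χ : DirichletCharacter ℂ q) {x : ℝ} (hx : 0 < x) :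
    HasSum (fun n : ℕ+ ↦ zetaMul χ n * (expWeight (n / x) : ℂ))
      (∑' p : ℕ+ × ℕ+, χ ((p.1 : ℕ) : ZMod q) * (expWeight (p.1 * p.2 / x) : ℂ)) := by
  have h := (summable_mul_expWeight χ hx).hasSum
  rw [← sigmaAntidiagonalEquivProd.hasSum_iff] at h
  refine h.sigma fun n ↦ ?_
  have e : zetaMul χ n * (expWeight (n / x) : ℂ) = ∑ p : Nat.divisorsAntidiagonal n,
      χ ((p.1.1 : ℕ) : ZMod q) * (expWeight (p.1.1 * p.1.2 / x) : ℂ) := by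
    rw [Finset.sum_coe_sort (Nat.divisorsAntidiagonal n)
      (fun p ↦ χ ((p.1 : ℕ) : ZMod q) * (expWeight (p.1 * p.2 / x) : ℂ)), zetaMul,
      mul_comm (_ : ArithmeticFunction ℂ), ArithmeticFunction.mul_apply, Finset.sum_mul]
    refine Finset.sum_congr rfl fun p hp ↦ ?_
    have hp' := Nat.mem_divisorsAntidiagonal.mp hp
    have h1 : p.1 ≠ 0 := left_ne_zero_of_mul (hp'.1 ▸ hp'.2)
    have h2 : p.2 ≠ 0 := right_ne_zero_of_mul (hp'.1 ▸ hp'.2)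
    rw [← apply_eq_toArithmeticFunction_apply χ h1, ArithmeticFunction.natCoe_apply,
      ArithmeticFunction.zeta_apply_ne h2, Nat.cast_one, mul_one]
    congr 3
    rw [← hp'.1]; push_cast; ring
  rw [e]
  exact hasSum_fintype _

lemma div_le_re_tsum_mul_expWeight {χ : DirichletCharacter ℂ q} (hχ : χ ^ 2 = 1) {k : ℕ}
    (hk : 1 ≤ k) :
    (k : ℝ) / 16 ≤ ‖∑' p : ℕ+ × ℕ+, χ ((p.1 : ℕ) : ZMod q) *
      (expWeight (p.1 * p.2 / (4 * (k : ℝ) ^ 2)) : ℂ)‖ := by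
  have hk' : (1 : ℝ) ≤ k := by exact_mod_cast hk
  have h := tsum_mul_expWeight_eq χ (show 0 < 4 * (k : ℝ) ^ 2 by positivity)
  have hre := hasSum_re h
  refine le_trans ?_ (re_le_norm _)
  let ι : ℕ → ℕ+ := fun i ↦ ⟨(k + i) ^ 2, by positivity⟩
  have hι : Function.Injective ι := by
    intro i j hij
    have : (k + i) ^ 2 = (k + j) ^ 2 := congrArg PNat.val hij
    have := Nat.pow_left_injective (n := 2) (by norm_num) this
    omega
  have hterm (n : ℕ+) : (zetaMul χ n * (expWeight (n / (4 * (k : ℝ) ^ 2)) : ℂ)).re =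
      (zetaMul χ n).re * expWeight (n / (4 * (k : ℝ) ^ 2)) := re_mul_ofReal _ _
  have h1 : ∑ n ∈ (Finset.range k).image ι,
      (zetaMul χ n * (expWeight (n / (4 * (k : ℝ) ^ 2)) : ℂ)).re ≤ _ :=
    sum_le_hasSum _ (fun n _ ↦ by
      rw [hterm]
      exact mul_nonneg (nonneg_iff.mp (zetaMul_nonneg hχ n)).1
        (expWeight_nonneg (by positivity))) hre
  refine le_trans ?_ h1
  rw [Finset.sum_image hι.injOn]
  calc (k : ℝ) / 16 = ∑ i ∈ Finset.range k, (1 / 16 : ℝ) := by simp; ring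
    _ ≤ _ := by
      refine Finset.sum_le_sum fun i hi ↦ ?_
      have hi' : (i : ℝ) ≤ k := by exact_mod_cast (Finset.mem_range.mp hi).le
      rw [hterm]
      have h2 : 1 ≤ (zetaMul χ (ι i)).re := by
        have := one_le_zetaMul_sq hχ (m := k + i) (by omega)
        exact (le_def.mp this).1
      have h3 : 1 / 16 ≤ expWeight ((ι i : ℕ) / (4 * (k : ℝ) ^ 2)) := by
        have e : ((ι i : ℕ) : ℝ) = (k + i) ^ 2 := by simp [ι]
        rw [e]
        refine one_div_sixteen_le_expWeight ?_ ?_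
        · rw [div_le_div_iff₀ (by norm_num) (by positivity)]
          nlinarith [Nat.cast_nonneg (α := ℝ) i]
        · rw [div_le_one (by positivity)]
          nlinarith [Nat.cast_nonneg (α := ℝ) i]
      have := mul_le_mul h2 h3 (by norm_num) (by linarith)
      simpa using this

end DirichletCharacter

end

section

open Complex Set Filter Topology

namespace DirichletCharacter

variable {q : ℕ} [NeZero q]

lemma sum_div_add_sq_le {x : ℝ} (hx : 1 ≤ x) (N : ℕ) :
    ∑ d ∈ Finset.range N, 24 / (x + d) ^ 2 ≤ 48 / x := by
  have h : ∀ N : ℕ, ∑ d ∈ Finset.range N, 24 / (x + d) ^ 2 ≤ 48 / x - 48 / (x + N) := by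
    intro N
    induction N with
    | zero => simp
    | succ n ih =>
      rw [Finset.sum_range_succ]
      have hn : (0 : ℝ) ≤ n := n.cast_nonneg
      have : 24 / (x + n) ^ 2 ≤ 48 / (x + n) - 48 / (x + (n + 1 : ℕ)) := by
        push_cast
        rw [div_sub_div _ _ (by positivity) (by positivity), div_le_div_iff₀ (by positivity)
          (by positivity)]
        have : 1 ≤ x + n := by linarith
        have h3 : 0 < (x + n) ^ 2 := by positivity
        nlinarith [mul_nonneg h3.le (sub_nonneg.mpr this)]
      linarith
  have : 0 ≤ 48 / (x + N) := by positivity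
  linarith [h N]

lemma norm_tsum_mul_expWeight_sub_le {χ : DirichletCharacter ℂ q} (hχ : χ.IsPrimitive)
    (hχ1 : χ ≠ 1) (h2 : χ ^ 2 = 1) {x : ℝ} (hx : 1 ≤ x) :
    ‖(∑' p : ℕ+ × ℕ+, χ ((p.1 : ℕ) : ZMod q) * (expWeight (p.1 * p.2 / x) : ℂ)) -
      x / 2 * LFunction χ 1‖ ≤ 49 / x * (q ^ 2 / (4 * √q)) := by
  have hx0 : 0 < x := by linarith
  have t1 := tendsto_sum_inv_sinh χ hx0
  have t2 := (tendsto_sum_div_LFunction_one hχ1).const_mul ((x : ℂ) / 2)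
  set a : ℕ → ℂ := fun d ↦ (cschRemainder (d / x) : ℂ) with ha
  have ha0 : a 0 = 0 := by simp [ha, cschRemainder]
  have key : ∀ N : ℕ, ∑ d ∈ Finset.range N, χ ((d + 1 : ℕ) : ZMod q) *
        (((2 * Real.sinh ((d + 1 : ℕ) / x))⁻¹ : ℝ) : ℂ) -
        x / 2 * ∑ k ∈ Finset.Icc 1 N, χ k / k = ∑ d ∈ Finset.range (N + 1), χ d * a d := by
    intro N
    rw [Finset.sum_range_succ', ha0, mul_zero, add_zero, Finset.range_eq_Ico,
      Finset.sum_Ico_add' (fun d : ℕ ↦ χ (d : ZMod q) * a d) 0 N 1,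
      Finset.sum_Ico_add' (fun d : ℕ ↦ χ (d : ZMod q) *
        (((2 * Real.sinh (d / x))⁻¹ : ℝ) : ℂ)) 0 N 1,
      ← Finset.Ico_add_one_right_eq_Icc, zero_add, Finset.mul_sum, ← Finset.sum_sub_distrib]
    refine Finset.sum_congr rfl fun d hd ↦ ?_
    have hd1 : (d : ℂ) ≠ 0 := by
      have := (Finset.mem_Ico.mp hd).1
      exact_mod_cast (by omega : d ≠ 0)
    have hxc : (x : ℂ) ≠ 0 := by exact_mod_cast hx0.ne'
    simp only [ha, cschRemainder]
    push_cast
    rw [mul_inv, inv_div]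
    ring
  have t3 : Tendsto (fun N : ℕ ↦ (1 / x + 48 / x + 3 * (x / (N + 1 : ℕ)) + x / (N + 2 : ℕ)) *
      ((q : ℝ) ^ 2 / (4 * √q))) atTop (𝓝 ((1 / x + 48 / x + 3 * 0 + 0) *
      ((q : ℝ) ^ 2 / (4 * √q)))) := by
    refine Tendsto.mul_const _ (Tendsto.add (Tendsto.add tendsto_const_nhds
      (Tendsto.const_mul 3 ?_)) ?_)
    · exact (tendsto_const_div_atTop_nhds_zero_nat x).comp (tendsto_add_atTop_nat 1)
    · exact (tendsto_const_div_atTop_nhds_zero_nat x).comp (tendsto_add_atTop_nat 2)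
  have hb : (1 / x + 48 / x + 3 * 0 + 0) * ((q : ℝ) ^ 2 / (4 * √q)) =
      49 / x * (q ^ 2 / (4 * √q)) := by ring
  rw [hb] at t3
  refine le_of_tendsto_of_tendsto (t1.sub t2).norm t3 (.of_forall fun N ↦ ?_)
  simp only
  rw [key N]
  have hdec : ∀ d : ℕ, d ≠ 0 → ‖a d‖ ≤ x / d := by
    intro d hd
    have hd' : (0 : ℝ) < d := by positivity
    simp only [ha, Complex.norm_real, Real.norm_eq_abs]
    simpa using abs_cschRemainder_le_inv (show 0 < d / x by positivity)
  have h1 : ‖a 1‖ ≤ 1 / x := by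
    simp only [ha, Complex.norm_real, Real.norm_eq_abs]
    simpa using abs_cschRemainder_le (show 0 ≤ 1 / x by positivity)
  have hE : ∀ d : ℕ, ‖a (d + 2) - 2 * a (d + 1) + a d‖ ≤ 24 / (x + d) ^ 2 := by
    intro d
    have := abs_second_difference_cschRemainder_le (show 0 ≤ d / x by positivity)
      (show 0 < 1 / x by positivity)
    have e : 24 / (1 + d / x) ^ 2 * (1 / x) ^ 2 = 24 / (x + d) ^ 2 := by
      have : 0 < x + d := by positivity
      field_simp
    rw [e] at this
    refine le_trans (le_of_eq ?_) this
    rw [← Real.norm_eq_abs, ← Complex.norm_real]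
    simp only [ha]
    push_cast
    congr 4
    · congr 1; ring
    · congr 2; ring
  refine (norm_sum_mul_le hχ hχ1 h2 ha0 hE (N + 1) (sum_div_add_sq_le hx _)).trans ?_
  gcongr
  · exact hdec _ (by omega)
  · exact hdec _ (by omega)

/-- The class number type lower bound for `L(1, χ)`, for primitive quadratic `χ`. -/
theorem le_norm_LFunction_one_of_isPrimitive {χ : DirichletCharacter ℂ q} (hχ : χ.IsPrimitive)
    (hχ1 : χ ≠ 1) (h2 : χ ^ 2 = 1) : 1 / (384 * √q) ≤ ‖LFunction χ 1‖ := by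
  have hq : (1 : ℝ) ≤ q := by exact_mod_cast NeZero.one_le
  have hr : 1 ≤ √(q : ℝ) := Real.one_le_sqrt.mpr hq
  set r := √(q : ℝ)
  have hrq : (q : ℝ) = r ^ 2 := (Real.sq_sqrt (by positivity)).symm
  set k := ⌈5 * r⌉₊
  have hk5 : 5 * r ≤ k := Nat.le_ceil _
  have hk6 : (k : ℝ) ≤ 6 * r := by
    have := Nat.ceil_lt_add_one (show 0 ≤ 5 * r by positivity)
    linarith
  have hk : (1 : ℝ) ≤ k := by linarith
  have h := norm_tsum_mul_expWeight_sub_le hχ hχ1 h2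
    (show 1 ≤ 4 * (k : ℝ) ^ 2 by nlinarith)
  have h' := div_le_re_tsum_mul_expWeight h2 (show 1 ≤ k by exact_mod_cast hk)
  have h3 := norm_le_insert' (∑' p : ℕ+ × ℕ+, χ ((p.1 : ℕ) : ZMod q) *
      (expWeight (p.1 * p.2 / (4 * (k : ℝ) ^ 2)) : ℂ))
      (((4 * (k : ℝ) ^ 2 : ℝ) : ℂ) / 2 * LFunction χ 1)
  have e : ‖((4 * (k : ℝ) ^ 2 : ℝ) : ℂ) / 2 * LFunction χ 1‖ = 2 * k ^ 2 * ‖LFunction χ 1‖ := by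
    rw [norm_mul, norm_div, Complex.norm_real, Real.norm_of_nonneg (by positivity)]
    simp; left; ring
  have e2 : 49 / (4 * (k : ℝ) ^ 2) * ((q : ℝ) ^ 2 / (4 * r)) ≤ k / 32 := by
    rw [hrq, div_mul_div_comm, div_le_div_iff₀ (by positivity) (by positivity)]
    have : (5 * r) ^ 3 ≤ (k : ℝ) ^ 3 := by gcongr
    have := mul_le_mul_of_nonneg_left this (show 0 ≤ r by positivity)
    nlinarith [show 0 ≤ r ^ 4 by positivity]
  have h4 : (k : ℝ) / 32 ≤ 2 * k ^ 2 * ‖LFunction χ 1‖ := by linarith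
  have h5 : 1 / (64 * k) ≤ ‖LFunction χ 1‖ := by
    rw [div_le_iff₀ (by positivity)]
    nlinarith
  refine le_trans ?_ h5
  rw [div_le_div_iff₀ (by positivity) (by positivity)]
  linarith

end DirichletCharacter

end

section

open Complex Set Filter Topology

namespace DirichletCharacter

lemma one_le_log_natCast {q : ℕ} (hq : 3 ≤ q) : 1 ≤ Real.log q := by
  have h3 : (3 : ℝ) ≤ q := by exact_mod_cast hq
  rw [Real.le_log_iff_exp_le (by linarith)]
  linarith [Real.exp_one_lt_d9]

lemma norm_LFunction_sub_one_le {f q : ℕ} [NeZero f] (hfq : f ≤ q) (hq : 3 ≤ q)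
    {χ : DirichletCharacter ℂ f} (hχ : χ ≠ 1) {s : ℂ}
    (hs : ‖s - 1‖ < 1 / (2 * Real.log q)) :
    ‖LFunction χ s - LFunction χ 1‖ ≤ 128 * Real.log q ^ 2 * ‖s - 1‖ := by
  have hl := one_le_log_natCast hq
  have h3 : (3 : ℝ) ≤ q := by exact_mod_cast hq
  have hf0 : (0 : ℝ) < f := by exact_mod_cast NeZero.pos f
  have hfq' : (f : ℝ) ≤ q := by exact_mod_cast hfq
  set l := Real.log q with hl'
  have hε' : 1 / (2 * l) ≤ 1 / 2 := by
    apply one_div_le_one_div_of_le (by norm_num); linarith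
  have hb : ∀ z : ℂ, ‖z - 1‖ < 1 / (2 * l) → ‖LFunction χ z‖ ≤ 32 * l := by
    intro z hz
    have hz1 : 1 - 1 / (2 * l) ≤ z.re := by
      have := (abs_le.mp ((Complex.abs_re_le_norm (z - 1)).trans hz.le)).1
      simp at this ⊢
      linarith
    have hzn : ‖z‖ ≤ 2 := by
      have := norm_le_insert' z 1
      rw [norm_one] at this
      linarith
    refine (norm_LFunction_le_near_one hχ (by positivity) hε' hz1).trans ?_
    have e : (3 * (f : ℝ)) ^ (2 * (1 / (2 * l))) ≤ 8 := by
      have e1 : 2 * (1 / (2 * l)) = 1 / l := by field_simp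
      rw [e1]
      calc (3 * (f : ℝ)) ^ (1 / l) ≤ ((q : ℝ) * q) ^ (1 / l) := by
            gcongr
        _ = Real.exp 2 := by
            rw [Real.rpow_def_of_pos (by positivity), Real.log_mul (by positivity) (by positivity),
              ← hl']
            congr 1; field_simp; ring
        _ ≤ 8 := by
            rw [show (2 : ℝ) = 1 + 1 by norm_num, Real.exp_add]
            nlinarith [Real.exp_one_lt_d9, Real.exp_pos 1]
    calc ‖z‖ * ((3 * (f : ℝ)) ^ (2 * (1 / (2 * l))) / (1 / (2 * l)))
        ≤ 2 * (8 / (1 / (2 * l))) := by gcongr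
      _ = 32 * l := by field_simp; ring
  have := Complex.dist_le_div_mul_dist_of_mapsTo_ball (f := LFunction χ) (c := 1) (z := s)
    (R₁ := 1 / (2 * l)) (R₂ := 64 * l) (differentiable_LFunction hχ).differentiableOn
    (fun z hz ↦ ?_) (by simpa [dist_eq_norm] using hs)
  · rw [dist_eq_norm, dist_eq_norm] at this
    refine this.trans_eq ?_
    field_simp
    ring
  · rw [mem_closedBall_iff_norm]
    have h1 := hb z (by simpa [dist_eq_norm] using hz)
    have h2 := hb 1 (by simp; linarith)
    linarith [norm_sub_le (LFunction χ z) (LFunction χ 1)]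

lemma LFunction_ne_zero_of_isPrimitive_of_near_one {f q : ℕ} [NeZero f] (hfq : f ≤ q) (hq : 3 ≤ q)
    {χ : DirichletCharacter ℂ f} (hχp : χ.IsPrimitive) (hχ : χ ≠ 1) (h2 : χ ^ 2 = 1) {s : ℂ}
    (hs : ‖s - 1‖ ≤ 1 / (100000 * (√q * Real.log q ^ 2))) : LFunction χ s ≠ 0 := by
  have hl := one_le_log_natCast hq
  have h3 : (1 : ℝ) ≤ q := by exact_mod_cast (by omega : 1 ≤ q)
  have hr : 1 ≤ √(q : ℝ) := Real.one_le_sqrt.mpr h3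
  have hf0 : (0 : ℝ) < f := by exact_mod_cast NeZero.pos f
  have hfr : √(f : ℝ) ≤ √q := Real.sqrt_le_sqrt (by exact_mod_cast hfq)
  have hfr0 : 0 < √(f : ℝ) := Real.sqrt_pos.mpr hf0
  intro h0
  have h1 := norm_LFunction_sub_one_le hfq hq hχ (s := s) (hs.trans_lt (by
    apply one_div_lt_one_div_of_lt (by positivity)
    nlinarith [mul_le_mul hr (mul_le_mul hl hl zero_le_one (by positivity)) (by positivity)
      (by positivity), mul_nonneg (sub_nonneg.mpr hr) (sq_nonneg (Real.log q))]))
  rw [h0, zero_sub, norm_neg] at h1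
  have h4 := le_norm_LFunction_one_of_isPrimitive hχp hχ h2
  have h5 : 1 / (384 * √(q : ℝ)) ≤ 1 / (384 * √f) := by gcongr
  have h6 : 128 * Real.log q ^ 2 * ‖s - 1‖ ≤ 128 * Real.log q ^ 2 *
      (1 / (100000 * (√q * Real.log q ^ 2))) := by gcongr
  have h7 : 128 * Real.log q ^ 2 * (1 / (100000 * (√q * Real.log q ^ 2))) <
      1 / (384 * √(q : ℝ)) := by
    rw [mul_one_div, div_lt_div_iff₀ (by positivity) (by positivity)]
    nlinarith [show 0 < Real.log q ^ 2 * √q by positivity]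
  linarith

lemma one_sub_mul_cpow_ne_zero {n : ℕ} (χ : DirichletCharacter ℂ n) (a : ZMod n) {p : ℕ}
    (hp : p.Prime) {s : ℂ} (hs : 0 < s.re) : 1 - χ a * (p : ℂ) ^ (-s) ≠ 0 := by
  intro h
  have h1 : ‖χ a * (p : ℂ) ^ (-s)‖ = 1 := by rw [← sub_eq_zero.mp h, norm_one]
  have h2 : ‖(p : ℂ) ^ (-s)‖ < 1 := by
    rw [Complex.norm_natCast_cpow_of_pos hp.pos, Complex.neg_re]
    exact Real.rpow_lt_one_of_one_lt_of_neg (by exact_mod_cast hp.one_lt) (by linarith)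
  rw [norm_mul] at h1
  nlinarith [χ.norm_le_one a, norm_nonneg (χ a), norm_nonneg ((p : ℂ) ^ (-s))]

theorem LFunction_ne_zero_of_near_one {q : ℕ} [NeZero q] (hq : 3 ≤ q)
    {χ : DirichletCharacter ℂ q} (hχ : χ ≠ 1) (h2 : χ ^ 2 = 1) {s : ℂ}
    (hs : ‖s - 1‖ ≤ 1 / (100000 * (√q * Real.log q ^ 2))) : LFunction χ s ≠ 0 := by
  have : NeZero χ.conductor := ⟨χ.conductor_ne_zero⟩
  have hr : 1 ≤ √(q : ℝ) := Real.one_le_sqrt.mpr (by exact_mod_cast (by omega : 1 ≤ q))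
  have hl := one_le_log_natCast hq
  have hχ' : χ.primitiveCharacter ≠ 1 := by
    intro h
    apply hχ
    rw [← χ.changeLevel_primitiveCharacter, h, map_one]
  have hs0 : 0 < s.re := by
    have h1 := (abs_le.mp ((Complex.abs_re_le_norm (s - 1)).trans hs)).1
    have h3 : 1 / (100000 * (√(q : ℝ) * Real.log q ^ 2)) ≤ 1 / 100000 := by
      apply one_div_le_one_div_of_le (by norm_num)
      have : 1 ≤ √(q : ℝ) * Real.log q ^ 2 := one_le_mul_of_one_le_of_one_le hr (one_le_pow₀ hl)
      linarith
    simp only [sub_re, one_re] at h1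
    linarith
  rw [← χ.changeLevel_primitiveCharacter, LFunction_changeLevel _ _ (.inl hχ')]
  refine mul_ne_zero (LFunction_ne_zero_of_isPrimitive_of_near_one
    (Nat.le_of_dvd (by omega) χ.conductor_dvd_level) hq χ.primitiveCharacter_isPrimitive hχ' ?_ hs)
    (Finset.prod_ne_zero_iff.mpr fun p hp ↦
      one_sub_mul_cpow_ne_zero _ _ (Nat.prime_of_mem_primeFactors hp) hs0)
  apply changeLevel_injective χ.conductor_dvd_level
  rw [map_pow, changeLevel_primitiveCharacter, h2, map_one]

end DirichletCharacter

end

section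

open Complex Set Filter Topology Metric
open scoped ArithmeticFunction.Moebius ArithmeticFunction.vonMangoldt

namespace DirichletCharacter

lemma tsum_norm_term_one_le {s : ℂ} (hs : 1 < s.re) (hs2 : s.re ≤ 2) :
    ∑' n, ‖LSeries.term 1 s n‖ ≤ 63 / (s.re - 1) := by
  have h0 : 0 < s.re - 1 := by linarith
  have e : ((∑' n, ‖LSeries.term 1 s n‖ : ℝ) : ℂ) = LFunctionTrivChar 1 (s.re : ℂ) := by
    rw [LFunctionTrivChar, LFunction_eq_LSeries _ (by simpa using hs), LSeries_modOne_eq, LSeries,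
      ofReal_tsum]
    refine tsum_congr fun n ↦ ?_
    rw [LSeries.norm_term_eq, LSeries.term_def]
    split_ifs with hn
    · simp
    · rw [Pi.one_apply, norm_one]
      push_cast
      rw [ofReal_cpow n.cast_nonneg]
      simp
  have h1 := norm_entireL_le (1 : DirichletCharacter ℂ 1) (s := (s.re : ℂ))
    (by simp only [ofReal_re]; linarith)
  have hne : (s.re : ℂ) ≠ 1 := by
    rw [Ne, ofReal_eq_one]; linarith
  rw [entireL, if_pos rfl, LFunctionTrivChar₁, Function.update_of_ne hne, ← e, norm_mul,
    ← ofReal_one, ← ofReal_sub, norm_real, norm_real, norm_real,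
    Real.norm_of_nonneg (tsum_nonneg fun n ↦ norm_nonneg _), Real.norm_of_nonneg h0.le,
    Real.norm_of_nonneg (by linarith)] at h1
  rw [le_div_iff₀ h0, mul_comm]
  refine h1.trans ?_
  push_cast
  nlinarith

lemma le_norm_LFunction {q : ℕ} [NeZero q] (χ : DirichletCharacter ℂ q) {s : ℂ} (hs : 1 < s.re)
    (hs2 : s.re ≤ 2) : (s.re - 1) / 63 ≤ ‖LFunction χ s‖ := by
  have h0 : 0 < s.re - 1 := by linarith
  have h1 := LSeries.mul_mu_eq_one χ hs
  rw [← LFunction_eq_LSeries χ hs] at h1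
  have h2 : ‖LSeries (((χ ·) : ℕ → ℂ) * fun n ↦ (μ n : ℂ)) s‖ ≤ 63 / (s.re - 1) := by
    refine le_trans ?_ (tsum_norm_term_one_le hs hs2)
    have hS : Summable fun n ↦ ‖LSeries.term 1 s n‖ := (LSeriesSummable_one_iff.mpr hs).norm
    refine tsum_of_norm_bounded hS.hasSum fun n ↦ LSeries.norm_term_le s ?_
    rw [Pi.mul_apply, Pi.one_apply, norm_one, norm_mul]
    refine mul_le_one₀ (χ.norm_le_one _) (norm_nonneg _) ?_
    rw [norm_intCast]
    exact_mod_cast ArithmeticFunction.abs_moebius_le_one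
  have h3 : 1 ≤ ‖LFunction χ s‖ * (63 / (s.re - 1)) := by
    have h4 := congrArg norm h1
    rw [norm_mul, norm_one] at h4
    exact h4.symm.le.trans (mul_le_mul_of_nonneg_left h2 (norm_nonneg _))
  rw [div_le_iff₀ (by norm_num)]
  rw [← mul_div_assoc, le_div_iff₀ h0] at h3
  linarith

variable {q : ℕ} [NeZero q]

lemma entireL_of_ne_one {χ : DirichletCharacter ℂ q} (hχ : χ ≠ 1) : entireL χ = LFunction χ :=
  if_neg hχ

lemma entireL_one : entireL (1 : DirichletCharacter ℂ q) = LFunctionTrivChar₁ q :=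
  if_pos rfl

lemma entireL_ne_zero_of_one_lt_re (χ : DirichletCharacter ℂ q) {s : ℂ} (hs : 1 < s.re) :
    entireL χ s ≠ 0 := by
  have hs1 : s ≠ 1 := by rintro rfl; simp at hs
  have h := LFunction_ne_zero_of_one_le_re χ (.inr hs1) hs.le
  rcases eq_or_ne χ 1 with rfl | hχ
  · rw [entireL_one, LFunctionTrivChar₁, Function.update_of_ne hs1]
    exact mul_ne_zero (sub_ne_zero.mpr hs1) h
  · rwa [entireL_of_ne_one hχ]

lemma le_norm_entireL (χ : DirichletCharacter ℂ q) {s : ℂ} (hs : 1 < s.re) (hs2 : s.re ≤ 2) :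
    (s.re - 1) ^ 2 / 63 ≤ ‖entireL χ s‖ := by
  have hs1 : s ≠ 1 := by rintro rfl; simp at hs
  have h := le_norm_LFunction χ hs hs2
  have h0 : 0 < s.re - 1 := by linarith
  rcases eq_or_ne χ 1 with rfl | hχ
  · rw [entireL_one, LFunctionTrivChar₁, Function.update_of_ne hs1, norm_mul, sq, mul_div_assoc]
    gcongr
    simpa using (le_abs_self _).trans (abs_re_le_norm (s - 1))
  · rw [entireL_of_ne_one hχ]
    refine le_trans ?_ h
    gcongr
    nlinarith

/-- The size of the conductor in the estimates below. -/
noncomputable def analyticConductor (q : ℕ) (τ : ℝ) : ℝ := 21 * q * (|τ| + 4)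

section

variable (χ : DirichletCharacter ℂ q) {a τ : ℝ}

lemma norm_entireL_scaled_le (ha : 0 < a) (ha1 : a ≤ 1) {z : ℂ} (hz : z ∈ ball (0 : ℂ) 1) :
    ‖entireL χ (1 + a + τ * I + z / 2)‖ ≤ ‖entireL χ (1 + a + τ * I + 0 / 2)‖ *
      Real.exp (2 * Real.log (analyticConductor q τ / a)) := by
  have hz1 : ‖z‖ < 1 := by simpa using hz
  have hz2 := abs_le.mp ((abs_re_le_norm z).trans hz1.le)
  have hq : (1 : ℝ) ≤ q := by exact_mod_cast NeZero.one_le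
  have hQ : 0 < analyticConductor q τ := by unfold analyticConductor; positivity
  have e : Real.exp (2 * Real.log (analyticConductor q τ / a)) =
      (analyticConductor q τ / a) ^ 2 := by
    rw [two_mul, Real.exp_add, Real.exp_log (by positivity), sq]
  have h1 := norm_entireL_le χ (s := 1 + a + τ * I + z / 2) (by simp; linarith)
  have h2 := le_norm_entireL χ (s := 1 + a + τ * I + 0 / 2) (by simpa using ha)
    (by simp; linarith)
  have hn : ‖1 + a + τ * I + z / 2‖ ≤ |τ| + 3 := by
    have t1 := norm_add_le (1 + a + τ * I) (z / 2)
    have t2 := norm_add_le (1 + (a : ℂ)) (τ * I)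
    have t3 := norm_add_le 1 (a : ℂ)
    rw [norm_one, norm_real, Real.norm_of_nonneg ha.le] at t3
    rw [norm_mul, norm_I, mul_one, norm_real, Real.norm_eq_abs] at t2
    rw [norm_div, RCLike.norm_ofNat] at t1
    linarith
  simp only [add_re, one_re, ofReal_re, mul_re, I_re, mul_zero, ofReal_im, I_im, mul_one,
    zero_div, add_zero, sub_self] at h2
  rw [e]
  calc ‖entireL χ (1 + a + τ * I + z / 2)‖ ≤ 7 * q * ((|τ| + 3) + 1) ^ 2 := h1.trans (by gcongr)
    _ ≤ 7 * q ^ 2 * (|τ| + 4) ^ 2 := by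
      rw [show |τ| + 3 + 1 = |τ| + 4 by ring]
      gcongr
      nlinarith
    _ = a ^ 2 / 63 * (analyticConductor q τ / a) ^ 2 := by
      unfold analyticConductor
      field_simp; ring
    _ ≤ _ := by
      gcongr
      simpa using h2

lemma hasDerivAt_entireL_scaled (w : ℂ) :
    HasDerivAt (fun z : ℂ ↦ entireL χ (w + z / 2)) (deriv (entireL χ) w * (1 / 2)) 0 := by
  have h1 : HasDerivAt (fun z : ℂ ↦ w + z / 2) (1 / 2) 0 :=
    ((hasDerivAt_id (0 : ℂ)).div_const 2).const_add _
  have h2 := ((differentiable_entireL χ) (w + 0 / 2)).hasDerivAt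
  have h3 := HasDerivAt.comp 0 h2 h1
  rw [zero_div, add_zero] at h3
  exact h3

lemma neg_re_logDeriv_entireL_le (ha : 0 < a) (ha1 : a ≤ 1) :
    -(deriv (entireL χ) (1 + a + τ * I) / entireL χ (1 + a + τ * I)).re ≤
      32 * Real.log (analyticConductor q τ / a) := by
  have hd := hasDerivAt_entireL_scaled χ (1 + a + τ * I)
  have h := neg_re_logDeriv_le (f := fun z : ℂ ↦ entireL χ (1 + a + τ * I + z / 2))
    (Differentiable.differentiableOn ((differentiable_entireL χ).comp (by fun_prop)))
    (entireL_ne_zero_of_one_lt_re χ (by simpa using ha))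
    (fun z hz ↦ norm_entireL_scaled_le χ ha ha1 hz)
    (fun z hz h0 ↦ by
      by_contra! hre
      exact entireL_ne_zero_of_one_lt_re χ (by simp; linarith) h0)
  rw [hd.deriv, zero_div, add_zero, mul_div_right_comm,
    show (1 / 2 : ℂ) = ((1 / 2 : ℝ) : ℂ) by simp,
    re_mul_ofReal] at h
  linarith

lemma neg_re_logDeriv_entireL_le_sub (ha : 0 < a) (ha1 : a ≤ 1) {δ : ℝ} (hδ : 0 < a + δ)
    (hδ1 : a + δ < 1 / 2) (h0 : entireL χ (1 - δ + τ * I) = 0) :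
    -(deriv (entireL χ) (1 + a + τ * I) / entireL χ (1 + a + τ * I)).re ≤
      32 * Real.log (analyticConductor q τ / a) - 1 / (a + δ) + 4 * (a + δ) := by
  have hd := hasDerivAt_entireL_scaled χ (1 + a + τ * I)
  have h := neg_re_logDeriv_le_sub (f := fun z : ℂ ↦ entireL χ (1 + a + τ * I + z / 2))
    (δ := 2 * (a + δ))
    (Differentiable.differentiableOn ((differentiable_entireL χ).comp (by fun_prop)))
    (entireL_ne_zero_of_one_lt_re χ (by simpa using ha))
    (fun z hz ↦ norm_entireL_scaled_le χ ha ha1 hz)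
    (fun z hz h0 ↦ by
      by_contra! hre
      exact entireL_ne_zero_of_one_lt_re χ (by simp; linarith) h0)
    (by positivity) (by linarith)
    (by
      rw [← h0]; congr 1; push_cast; ring)
  rw [hd.deriv, zero_div, add_zero, mul_div_right_comm,
    show (1 / 2 : ℂ) = ((1 / 2 : ℝ) : ℂ) by simp,
    re_mul_ofReal] at h
  have e : 1 / (2 * (a + δ)) = 1 / (a + δ) / 2 := by field_simp
  rw [e] at h
  linarith

end

end DirichletCharacter

end

section

open Complex Set Filter Topology Metric
open scoped ArithmeticFunction.Moebius ArithmeticFunction.vonMangoldt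

namespace DirichletCharacter

lemma term_twist_vonMangoldt {q : ℕ} (χ : DirichletCharacter ℂ q) (a τ : ℝ) {n : ℕ} (hn : n ≠ 0) :
    LSeries.term (((χ ·) : ℕ → ℂ) * fun n ↦ (Λ n : ℂ)) (1 + a + τ * I) n =
      ((Λ n / (n : ℝ) ^ (1 + a) : ℝ) : ℂ) * (χ n * (n : ℂ) ^ (-(τ * I))) := by
  rw [LSeries.term_of_ne_zero hn, cpow_add _ _ (by exact_mod_cast hn), cpow_neg, ofReal_div,
    ofReal_cpow n.cast_nonneg, Pi.mul_apply]
  push_cast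
  field_simp

lemma re_three_four_one_nonneg {q : ℕ} (χ : DirichletCharacter ℂ q) {a : ℝ} (ha : 0 < a) (τ : ℝ) :
    0 ≤ (3 * LSeries (((1 : DirichletCharacter ℂ q) · : ℕ → ℂ) * fun n ↦ (Λ n : ℂ))
        (1 + a + (0 : ℝ) * I) +
      4 * LSeries (((χ ·) : ℕ → ℂ) * fun n ↦ (Λ n : ℂ)) (1 + a + τ * I) +
      LSeries ((((χ ^ 2) ·) : ℕ → ℂ) * fun n ↦ (Λ n : ℂ)) (1 + a + (2 * τ : ℝ) * I)).re := by
  have hs : ∀ t : ℝ, 1 < (1 + a + t * I : ℂ).re := fun t ↦ by simpa using ha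
  have h1 := (LSeriesSummable_twist_vonMangoldt (1 : DirichletCharacter ℂ q) (hs 0)).hasSum
  have h2 := (LSeriesSummable_twist_vonMangoldt χ (hs τ)).hasSum
  have h3 := (LSeriesSummable_twist_vonMangoldt (χ ^ 2) (hs (2 * τ))).hasSum
  have h := ((h1.mul_left 3).add (h2.mul_left 4)).add h3
  have h' := Complex.hasSum_re h
  refine h'.nonneg fun n ↦ ?_
  rcases eq_or_ne n 0 with rfl | hn
  · simp
  rw [term_twist_vonMangoldt _ _ _ hn, term_twist_vonMangoldt _ _ _ hn,
    term_twist_vonMangoldt _ _ _ hn]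
  have hc : 0 ≤ Λ n / (n : ℝ) ^ (1 + a) := by
    have : 0 ≤ Λ n := ArithmeticFunction.vonMangoldt_nonneg
    positivity
  have e : ∀ c u v w : ℂ, 3 * (c * u) + 4 * (c * v) + c * w = c * (3 * u + 4 * v + w) := by
    intros; ring
  rw [e, re_ofReal_mul]
  refine mul_nonneg hc ?_
  by_cases hu : IsUnit (n : ZMod q)
  · set w := χ n * (n : ℂ) ^ (-(τ * I)) with hw
    have hw2 : (χ ^ 2) n * (n : ℂ) ^ (-((2 * τ : ℝ) * I)) = w ^ 2 := by
      rw [hw, mul_pow, ← cpow_nat_mul, MulChar.pow_apply' _ two_ne_zero]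
      congr 2
      push_cast; ring
    have hwn : ‖w‖ = 1 := by
      rw [hw, norm_mul, norm_natCast_cpow_of_pos (Nat.pos_of_ne_zero hn)]
      have : ‖χ n‖ = 1 := by
        obtain ⟨u, hu⟩ := hu
        rw [← hu]; exact χ.unit_norm_eq_one u
      simp [this]
    rw [hw2, MulChar.one_apply hu]
    have hsq : w.re ^ 2 + w.im ^ 2 = 1 := by
      have := Complex.sq_norm w
      rw [hwn, normSq_apply] at this
      nlinarith
    simp [sq] at hsq ⊢
    nlinarith [sq_nonneg (1 + w.re)]
  · rw [MulChar.map_nonunit _ hu, MulChar.map_nonunit _ hu, MulChar.map_nonunit _ hu]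
    simp

variable {q : ℕ} [NeZero q]

lemma LSeries_twist_vonMangoldt_eq_of_ne_one {χ : DirichletCharacter ℂ q} (hχ : χ ≠ 1) {s : ℂ}
    (hs : 1 < s.re) : LSeries (((χ ·) : ℕ → ℂ) * fun n ↦ (Λ n : ℂ)) s =
      -(deriv (entireL χ) s / entireL χ s) := by
  rw [LSeries_twist_vonMangoldt_eq χ hs, entireL_of_ne_one hχ,
    deriv_LFunction_eq_deriv_LSeries χ hs, LFunction_eq_LSeries χ hs, neg_div]

lemma LSeries_one_twist_vonMangoldt_eq {s : ℂ} (hs : 1 < s.re) :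
    LSeries (((1 : DirichletCharacter ℂ q) · : ℕ → ℂ) * fun n ↦ (Λ n : ℂ)) s =
      1 / (s - 1) - deriv (entireL (1 : DirichletCharacter ℂ q)) s /
        entireL (1 : DirichletCharacter ℂ q) s := by
  have hs1 : s ≠ 1 := by rintro rfl; simp at hs
  have h := LFunction_ne_zero_of_one_le_re (1 : DirichletCharacter ℂ q) (.inr hs1) hs.le
  rw [LSeries_twist_vonMangoldt_eq _ hs, entireL_one,
    deriv_LFunctionTrivChar₁_apply_of_ne_one _ hs1,
    ← deriv_LFunction_eq_deriv_LSeries _ hs, ← LFunction_eq_LSeries _ hs,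
    LFunctionTrivChar₁, Function.update_of_ne hs1]
  have := sub_ne_zero.mpr hs1
  field_simp
  ring

lemma re_LSeries_twist_le (χ : DirichletCharacter ℂ q) {a τ : ℝ} (ha : 0 < a) (ha1 : a ≤ 1) {m : ℝ}
    (hm : 0 ≤ m) (h : χ = 1 → (1 / (a + τ * I : ℂ)).re ≤ m) :
    (LSeries (((χ ·) : ℕ → ℂ) * fun n ↦ (Λ n : ℂ)) (1 + a + τ * I)).re ≤
      m + 32 * Real.log (analyticConductor q τ / a) := by
  have h1 := neg_re_logDeriv_entireL_le χ (τ := τ) ha ha1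
  rcases eq_or_ne χ 1 with rfl | hχ
  · rw [LSeries_one_twist_vonMangoldt_eq (by simpa using ha), sub_re,
      show (1 + a + τ * I - 1 : ℂ) = a + τ * I by ring]
    linarith [h rfl]
  · rw [LSeries_twist_vonMangoldt_eq_of_ne_one hχ (by simpa using ha), neg_re]
    linarith

lemma analyticConductor_pos (τ : ℝ) : 0 < analyticConductor q τ := by
  have hq : (0 : ℝ) < q := by exact_mod_cast NeZero.pos q
  unfold analyticConductor; positivity

lemma log_analyticConductor_div_le {a τ τ' : ℝ} (ha : 0 < a) (h : |τ'| ≤ 2 * |τ|) :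
    Real.log (analyticConductor q τ' / a) ≤ Real.log (2 * analyticConductor q τ / a) := by
  have h1 := analyticConductor_pos (q := q) τ'
  apply Real.log_le_log (by positivity)
  gcongr
  unfold analyticConductor
  have hq : (0 : ℝ) < q := by exact_mod_cast NeZero.pos q
  nlinarith [abs_nonneg τ]

lemma LFunction_ne_zero_of_le {χ : DirichletCharacter ℂ q} (hχ : χ ≠ 1) {a τ δ : ℝ} (ha : 0 < a)
    (ha' : a ≤ 1 / (10 ^ 8 * Real.log (2 * analyticConductor q τ)))
    (hτ : χ ^ 2 = 1 → a ≤ |τ|) (hδ : 0 ≤ δ) (hδ' : δ ≤ a / 10) :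
    LFunction χ (1 - δ + τ * I) ≠ 0 := by
  intro h0
  set Q := 2 * analyticConductor q τ with hQ
  have hQ2 : 4 ≤ Q := by
    have hq : (1 : ℝ) ≤ q := by exact_mod_cast NeZero.one_le
    rw [hQ, analyticConductor]
    nlinarith [abs_nonneg τ]
  have hlog : 1 ≤ Real.log Q := by
    rw [Real.le_log_iff_exp_le (by linarith)]
    linarith [Real.exp_one_lt_d9]
  have ha8 : a ≤ 1 / 10 ^ 8 := ha'.trans (by
    apply one_div_le_one_div_of_le (by norm_num); nlinarith)
  have ha1 : a ≤ 1 := by linarith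
  have hlogQa : a * Real.log (Q / a) ≤ 3 / 10 ^ 4 := by
    rw [Real.log_div (by positivity) ha.ne', mul_sub]
    have h1 : a * Real.log Q ≤ 1 / 10 ^ 8 := by
      rw [le_div_iff₀ (by positivity)] at ha'
      linarith
    have h2 : -(a * Real.log a) ≤ 2 * √a := by
      have hs : 0 < √a := Real.sqrt_pos.mpr ha
      have h3 : Real.log (√a)⁻¹ ≤ (√a)⁻¹ :=
        (Real.log_le_sub_one_of_pos (by positivity)).trans (by linarith)
      rw [Real.log_inv, Real.log_sqrt ha.le] at h3
      have h4 := mul_le_mul_of_nonneg_left h3 ha.le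
      have h5 : a * (√a)⁻¹ = √a := by
        field_simp; exact (Real.sq_sqrt ha.le).symm
      linarith
    have h3 : √a ≤ 1 / 10 ^ 4 := by
      rw [Real.sqrt_le_left (by norm_num)]
      linarith
    linarith
  have T := re_three_four_one_nonneg χ ha τ
  have t0 := re_LSeries_twist_le (1 : DirichletCharacter ℂ q) (τ := 0) ha ha1 (m := 1 / a)
    (by positivity) (fun _ ↦ by
      rw [ofReal_zero, zero_mul, add_zero, ← ofReal_one, ← ofReal_div, ofReal_re])
  have t1 := neg_re_logDeriv_entireL_le_sub χ (τ := τ) ha ha1 (δ := δ) (by linarith)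
    (by linarith) (by rwa [entireL_of_ne_one hχ])
  have e1 := LSeries_twist_vonMangoldt_eq_of_ne_one hχ (s := 1 + a + τ * I) (by simpa using ha)
  have t2 := re_LSeries_twist_le (χ ^ 2) (τ := 2 * τ) ha ha1 (m := 1 / (5 * a))
    (by positivity) (fun h ↦ by
      have hh := hτ h
      rw [one_div, inv_re, normSq_add_mul_I]
      simp only [add_re, ofReal_re, mul_re, I_re, mul_zero, ofReal_im, I_im, mul_one, sub_self,
        add_zero]
      rw [div_le_div_iff₀ (by positivity) (by positivity)]
      have : a ^ 2 ≤ τ ^ 2 := by rw [← sq_abs τ]; gcongr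
      nlinarith)
  have l0 := log_analyticConductor_div_le (q := q) (τ := τ) (τ' := 0) ha (by simp)
  have l1 := log_analyticConductor_div_le (q := q) (τ := τ) (τ' := τ) ha
    (by linarith [abs_nonneg τ])
  have l2 := log_analyticConductor_div_le (q := q) (τ := τ) (τ' := 2 * τ) ha
    (by rw [abs_mul]; norm_num)
  rw [← hQ] at l0 l1 l2
  have T' : 0 ≤ 3 * (1 / a) - 4 * (1 / (a + δ)) + 16 * (a + δ) + 1 / (5 * a) +
      256 * Real.log (Q / a) := by
    rw [e1] at T
    simp only [add_re, mul_re, re_ofNat, im_ofNat, zero_mul, sub_zero, neg_re] at T t0 t1 t2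
    linarith
  have h4 : 1 / (11 / 10 * a) ≤ 1 / (a + δ) := by
    apply one_div_le_one_div_of_le <;> linarith
  have T2 := mul_nonneg ha.le T'
  have e5 : a * (3 * (1 / a) - 4 * (1 / (a + δ)) + 16 * (a + δ) + 1 / (5 * a) +
      256 * Real.log (Q / a)) = 3 - 4 * (a * (1 / (a + δ))) + 16 * (a * (a + δ)) + 1 / 5 +
      256 * (a * Real.log (Q / a)) := by
    field_simp
  have h5 := mul_le_mul_of_nonneg_left h4 ha.le
  have e6 : a * (1 / (11 / 10 * a)) = 10 / 11 := by field_simp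
  have h7 : a * (a + δ) ≤ 1 / 1000 := by nlinarith
  rw [e5] at T2
  rw [e6] at h5
  linarith

/-- A zero-free region for the nontrivial Dirichlet `L`-functions of modulus `q`, which takes
the exceptional zeros into account. -/
theorem LFunction_ne_zero_of_zeroFree {χ : DirichletCharacter ℂ q} (hq : 3 ≤ q) (hχ : χ ≠ 1)
    {s : ℂ} (hs : 1 - 1 / (10 ^ 11 * (√q * Real.log q ^ 2)) /
      (1 + max 0 (Real.log |s.im|)) < s.re) :
    LFunction χ s ≠ 0 := by
  rcases le_or_gt 1 s.re with h1 | h1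
  · exact LFunction_ne_zero_of_one_le_re χ (.inl hχ) h1
  have hl := one_le_log_natCast hq
  have hq1 : (1 : ℝ) ≤ q := by exact_mod_cast (by omega : 1 ≤ q)
  have hr : 1 ≤ √(q : ℝ) := Real.one_le_sqrt.mpr hq1
  set τ := s.im with hτ
  set m := max 0 (Real.log |τ|) with hm
  have hm0 : 0 ≤ m := le_max_left _ _
  set δ := 1 - s.re with hδ
  have hδ0 : 0 < δ := by linarith
  have hse : s = 1 - δ + τ * I := by
    apply Complex.ext <;> simp [hδ, hτ]
  have hδm : δ * (1 + m) ≤ 1 / (10 ^ 11 * (√q * Real.log q ^ 2)) := by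
    rw [← le_div_iff₀ (by positivity)]; linarith
  set l := Real.log q with hl'
  have hlogQ : Real.log (2 * analyticConductor q τ) ≤ 7 * (l * (1 + m)) := by
    have hmax : 1 ≤ max 1 |τ| := le_max_left _ _
    have hm' : m = Real.log (max 1 |τ|) := by
      rcases le_total |τ| 1 with h | h
      · rw [max_eq_left h, Real.log_one, hm, max_eq_left]
        exact Real.log_nonpos (abs_nonneg _) h
      · rw [max_eq_right h, hm, max_eq_right]
        exact Real.log_nonneg h
    have h2 : 2 * analyticConductor q τ ≤ Real.exp 6 * q * max 1 |τ| := by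
      have h6 : (210 : ℝ) ≤ Real.exp 6 := by
        have : (2.5 : ℝ) ≤ Real.exp 1 := by linarith [Real.exp_one_gt_d9]
        calc (210 : ℝ) ≤ 2.5 ^ 6 := by norm_num
          _ ≤ Real.exp 1 ^ 6 := by gcongr
          _ = Real.exp 6 := by rw [← Real.exp_nat_mul]; norm_num
      have h7 : |τ| + 4 ≤ 5 * max 1 |τ| := by linarith [le_max_right 1 |τ|]
      calc 2 * analyticConductor q τ = 42 * q * (|τ| + 4) := by rw [analyticConductor]; ring
        _ ≤ 42 * q * (5 * max 1 |τ|) := by gcongr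
        _ = 210 * q * max 1 |τ| := by ring
        _ ≤ _ := by gcongr
    have h3 := Real.log_le_log (by have := analyticConductor_pos (q := q) τ; positivity) h2
    rw [Real.log_mul (x := Real.exp 6 * q) (by positivity) (by positivity),
      Real.log_mul (x := Real.exp 6) (by positivity) (by positivity), Real.log_exp, ← hm',
      ← hl'] at h3
    nlinarith [mul_nonneg (sub_nonneg.mpr hl) hm0]
  have hQ1 : 1 ≤ Real.log (2 * analyticConductor q τ) := by
    rw [Real.le_log_iff_exp_le (by have := analyticConductor_pos (q := q) τ; positivity)]
    rw [analyticConductor]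
    nlinarith [abs_nonneg τ, Real.exp_one_lt_d9]
  set a₀ := 1 / (10 ^ 8 * Real.log (2 * analyticConductor q τ)) with ha₀
  have ha₀p : 0 < a₀ := by positivity
  have h10 : δ ≤ a₀ / 10 := by
    have h2 : δ * (l * (1 + m)) ≤ 1 / 10 ^ 11 := by
      have h3 : 1 / (10 ^ 11 * (√q * l ^ 2)) ≤ 1 / (10 ^ 11 * l) := by
        gcongr
        nlinarith [mul_nonneg (sub_nonneg.mpr hr) (sq_nonneg l)]
      have h4 := mul_le_mul_of_nonneg_left (hδm.trans h3) (show 0 ≤ l by linarith)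
      have h5 : l * (1 / (10 ^ 11 * l)) = 1 / 10 ^ 11 := by field_simp
      linarith
    rw [ha₀, div_div, le_div_iff₀ (by positivity)]
    nlinarith
  by_cases h2 : χ ^ 2 = 1
  · rcases le_or_gt (10 * δ) |τ| with ht | ht
    · rw [hse]
      exact LFunction_ne_zero_of_le hχ (a := min |τ| a₀) (lt_min (by linarith) ha₀p)
        (min_le_right _ _) (fun _ ↦ min_le_left _ _) hδ0.le
        (by rw [le_div_iff₀ (by norm_num)]; exact le_min (by linarith) (by linarith))
    · refine LFunction_ne_zero_of_near_one hq hχ h2 ?_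
      have h3 : ‖s - 1‖ ≤ 11 * δ := by
        rw [hse, show (1 - δ + τ * I - 1 : ℂ) = -(δ : ℂ) + τ * I by ring]
        have := norm_add_le (-(δ : ℂ)) (τ * I)
        rw [norm_neg, norm_real, norm_mul, norm_I, norm_real, mul_one, Real.norm_eq_abs,
          Real.norm_eq_abs, abs_of_pos hδ0] at this
        linarith
      have h4 : δ ≤ 1 / (10 ^ 11 * (√q * l ^ 2)) := by nlinarith
      have h5 : 11 * (1 / (10 ^ 11 * (√q * l ^ 2))) ≤ 1 / (100000 * (√q * l ^ 2)) := by
        rw [mul_one_div, div_le_div_iff₀ (by positivity) (by positivity)]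
        nlinarith [show 0 < √(q : ℝ) * l ^ 2 by positivity]
      linarith
  · rw [hse]
    exact LFunction_ne_zero_of_le hχ ha₀p le_rfl (fun h ↦ absurd h h2) hδ0.le h10

end DirichletCharacter

end

section

open Complex

section EulerLog

/-- The logarithm of the Euler product with coefficients `a`. -/
noncomputable def eulerLog (a : Nat.Primes → ℂ) (s : ℂ) : ℂ :=
  ∑' p : Nat.Primes, -log (1 - a p * (p : ℂ) ^ (-s))

lemma norm_log_one_sub_add_self_le {w : ℂ} {r : ℝ} (hr : r < 1) (hw : ‖w‖ ≤ r) :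
    ‖log (1 - w) + w‖ ≤ (1 - r)⁻¹ * ‖w‖ ^ 2 := by
  have h := norm_log_one_add_sub_self_le (z := -w) (by simpa using hw.trans_lt hr)
  rw [norm_neg, sub_neg_eq_add, ← sub_eq_add_neg] at h
  have h1 : (1 - ‖w‖)⁻¹ ≤ (1 - r)⁻¹ := inv_anti₀ (by linarith) (by linarith)
  have h2 : 0 ≤ (1 - ‖w‖)⁻¹ := inv_nonneg.mpr (by linarith)
  nlinarith [sq_nonneg ‖w‖, mul_le_mul_of_nonneg_left h1 (sq_nonneg ‖w‖),
    mul_nonneg (sq_nonneg ‖w‖) h2]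

lemma norm_prime_cpow_neg_le {p : Nat.Primes} {s : ℂ} {σ : ℝ} (hσ : σ ≤ s.re) :
    ‖(p : ℂ) ^ (-s)‖ ≤ (p : ℝ) ^ (-σ) := by
  rw [norm_natCast_cpow_of_pos p.2.pos, neg_re]
  exact Real.rpow_le_rpow_of_exponent_le (mod_cast p.2.one_le) (by linarith)

lemma norm_mul_prime_cpow_neg_le {p : Nat.Primes} {s z : ℂ} {σ : ℝ} (hz : ‖z‖ ≤ 1)
    (hσ : σ ≤ s.re) : ‖z * (p : ℂ) ^ (-s)‖ ≤ (p : ℝ) ^ (-σ) := by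
  rw [norm_mul]
  exact (mul_le_of_le_one_left (norm_nonneg _) hz).trans (norm_prime_cpow_neg_le hσ)

lemma prime_rpow_neg_le (p : Nat.Primes) {σ : ℝ} (hσ : 0 ≤ σ) :
    (p : ℝ) ^ (-σ) ≤ (2 : ℝ) ^ (-σ) :=
  Real.rpow_le_rpow_of_nonpos (by norm_num) (mod_cast p.2.two_le) (by linarith)

lemma two_rpow_neg_lt_one {σ : ℝ} (hσ : 0 < σ) : (2 : ℝ) ^ (-σ) < 1 :=
  Real.rpow_lt_one_of_one_lt_of_neg (by norm_num) (by linarith)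

lemma norm_log_one_sub_mul_prime_cpow_add_le {p : Nat.Primes} {s z : ℂ} {σ : ℝ} (hz : ‖z‖ ≤ 1)
    (h0 : 0 < σ) (hσ : σ ≤ s.re) :
    ‖log (1 - z * (p : ℂ) ^ (-s)) + z * (p : ℂ) ^ (-s)‖ ≤
      (1 - (2 : ℝ) ^ (-σ))⁻¹ * (p : ℝ) ^ (-(2 * σ)) := by
  have h1 := norm_mul_prime_cpow_neg_le (p := p) hz hσ
  have h2 := two_rpow_neg_lt_one h0
  refine (norm_log_one_sub_add_self_le h2 (h1.trans (prime_rpow_neg_le p h0.le))).trans ?_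
  refine mul_le_mul_of_nonneg_left ?_ (inv_nonneg.mpr (by linarith))
  calc _ ≤ ((p : ℝ) ^ (-σ)) ^ 2 := pow_le_pow_left₀ (norm_nonneg _) h1 2
    _ = _ := by
      rw [← Real.rpow_natCast, ← Real.rpow_mul (by positivity)]
      congr 1
      push_cast
      ring

lemma norm_log_one_sub_mul_prime_cpow_le {p : Nat.Primes} {s z : ℂ} {σ : ℝ} (hz : ‖z‖ ≤ 1)
    (h0 : 0 < σ) (hσ : σ ≤ s.re) :
    ‖-log (1 - z * (p : ℂ) ^ (-s))‖ ≤
      (1 - (2 : ℝ) ^ (-σ))⁻¹ * (p : ℝ) ^ (-(2 * σ)) + (p : ℝ) ^ (-σ) := by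
  have h1 := norm_mul_prime_cpow_neg_le (p := p) hz hσ
  have h2 := norm_log_one_sub_mul_prime_cpow_add_le (p := p) hz h0 hσ
  have h3 := norm_sub_le (log (1 - z * (p : ℂ) ^ (-s)) + z * (p : ℂ) ^ (-s)) (z * (p : ℂ) ^ (-s))
  rw [add_sub_cancel_right] at h3
  rw [norm_neg]
  linarith

lemma differentiableAt_log_one_sub_mul_prime_cpow (p : Nat.Primes) {s z : ℂ} (hz : ‖z‖ ≤ 1)
    (hs : 0 < s.re) : DifferentiableAt ℂ (fun w ↦ -log (1 - z * (p : ℂ) ^ (-w))) s := by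
  have hp : (p : ℂ) ≠ 0 := mod_cast p.2.ne_zero
  have h1 : ‖-(z * (p : ℂ) ^ (-s))‖ < 1 := by
    rw [norm_neg]
    exact ((norm_mul_prime_cpow_neg_le hz le_rfl).trans (prime_rpow_neg_le p hs.le)).trans_lt
      (two_rpow_neg_lt_one hs)
  have h2 := mem_slitPlane_of_norm_lt_one h1
  rw [← sub_eq_add_neg] at h2
  refine DifferentiableAt.fun_neg
    (DifferentiableAt.clog (f := fun w ↦ 1 - z * (p : ℂ) ^ (-w)) ?_ h2)
  exact (differentiableAt_const _).sub ((differentiableAt_const _).mul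
    (differentiableAt_id.neg.const_cpow (Or.inl hp)))

variable {a b : Nat.Primes → ℂ}

lemma summable_log_bound {σ : ℝ} (hσ : 1 < σ) :
    Summable fun p : Nat.Primes ↦
      (1 - (2 : ℝ) ^ (-σ))⁻¹ * (p : ℝ) ^ (-(2 * σ)) + (p : ℝ) ^ (-σ) :=
  ((Nat.Primes.summable_rpow.mpr (by linarith)).mul_left _).add
    (Nat.Primes.summable_rpow.mpr (by linarith))

lemma summable_eulerLog (ha : ∀ p, ‖a p‖ ≤ 1) {s : ℂ} (hs : 1 < s.re) :
    Summable fun p : Nat.Primes ↦ -log (1 - a p * (p : ℂ) ^ (-s)) :=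
  .of_norm_bounded (summable_log_bound hs)
    fun p ↦ norm_log_one_sub_mul_prime_cpow_le (ha p) (by linarith) le_rfl

lemma isOpen_lt_re (σ : ℝ) : IsOpen {s : ℂ | σ < s.re} :=
  isOpen_lt continuous_const continuous_re

lemma differentiableOn_eulerLog (ha : ∀ p, ‖a p‖ ≤ 1) :
    DifferentiableOn ℂ (eulerLog a) {s | 1 < s.re} := by
  intro s hs
  obtain ⟨σ, h1, h2⟩ := exists_between (show (1 : ℝ) < s.re from hs)
  have h := differentiableOn_tsum_of_summable_norm (summable_log_bound h1)
    (F := fun p w ↦ -log (1 - a p * (p : ℂ) ^ (-w))) (U := {w | σ < w.re})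
    (fun p w hw ↦ (differentiableAt_log_one_sub_mul_prime_cpow p (ha p)
      (by linarith [show σ < w.re from hw])).differentiableWithinAt) (isOpen_lt_re σ)
    fun p w hw ↦ norm_log_one_sub_mul_prime_cpow_le (ha p) (by linarith) (le_of_lt hw)
  exact (h.differentiableAt ((isOpen_lt_re σ).mem_nhds h2)).differentiableWithinAt

/-- If the coefficients `b` are a linear combination of the `a i`, then the logarithms of the
Euler products satisfy the same relation up to a function analytic for `1 / 2 < re s`. -/
lemma exists_eulerLog_eq_add_sum {ι : Type*} (t : Finset ι) (c : ι → ℂ) {α : ι → Nat.Primes → ℂ}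
    (hb : ∀ p, ‖b p‖ ≤ 1) (hα : ∀ i p, ‖α i p‖ ≤ 1) (h : ∀ p, b p = ∑ i ∈ t, c i * α i p) :
    ∃ H : ℂ → ℂ, DifferentiableOn ℂ H {s | 1 / 2 < s.re} ∧
      ∀ s : ℂ, 1 < s.re → eulerLog b s = H s + ∑ i ∈ t, c i * eulerLog (α i) s := by
  let F : Nat.Primes → ℂ → ℂ := fun p s ↦ -log (1 - b p * (p : ℂ) ^ (-s)) -
    ∑ i ∈ t, c i * -log (1 - α i p * (p : ℂ) ^ (-s))
  refine ⟨fun s ↦ ∑' p, F p s, fun s hs ↦ ?_, fun s hs ↦ ?_⟩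
  · obtain ⟨σ, h1, h2⟩ := exists_between (show (1 / 2 : ℝ) < s.re from hs)
    have hσ : 0 < σ := by linarith
    let K : ℝ := (1 - (2 : ℝ) ^ (-σ))⁻¹
    have hu : Summable fun p : Nat.Primes ↦ (1 + ∑ i ∈ t, ‖c i‖) * (K * (p : ℝ) ^ (-(2 * σ))) :=
      ((Nat.Primes.summable_rpow.mpr (by linarith)).mul_left _).mul_left _
    refine ((differentiableOn_tsum_of_summable_norm hu (F := F) (U := {w | σ < w.re})
      (fun p w hw ↦ ?_) (isOpen_lt_re σ) fun p w hw ↦ ?_).differentiableAt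
        ((isOpen_lt_re σ).mem_nhds h2)).differentiableWithinAt
    · have hw0 : 0 < w.re := hσ.trans hw
      refine (DifferentiableAt.sub (differentiableAt_log_one_sub_mul_prime_cpow p (hb p) hw0)
        (DifferentiableAt.fun_sum fun i _ ↦ ?_)).differentiableWithinAt
      exact (differentiableAt_log_one_sub_mul_prime_cpow p (hα i p) hw0).const_mul _
    · set z := (p : ℂ) ^ (-w)
      have e : F p w = -(log (1 - b p * z) + b p * z) +
          ∑ i ∈ t, c i * (log (1 - α i p * z) + α i p * z) := by
        simp only [F, mul_add, Finset.sum_add_distrib, mul_neg, Finset.sum_neg_distrib]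
        have : ∑ i ∈ t, c i * (α i p * z) = b p * z := by
          rw [h p, Finset.sum_mul]
          exact Finset.sum_congr rfl fun i _ ↦ by ring
        rw [this]
        ring
      rw [e, add_mul, one_mul, Finset.sum_mul]
      refine (norm_add_le _ _).trans (add_le_add ?_ ((norm_sum_le _ _).trans
        (Finset.sum_le_sum fun i _ ↦ ?_)))
      · rw [norm_neg]
        exact norm_log_one_sub_mul_prime_cpow_add_le (hb p) hσ (le_of_lt hw)
      · rw [norm_mul]
        exact mul_le_mul_of_nonneg_left
          (norm_log_one_sub_mul_prime_cpow_add_le (hα i p) hσ (le_of_lt hw)) (norm_nonneg _)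
  · have hS (i : ι) := (summable_eulerLog (hα i) hs).mul_left (c i)
    simp only [F, eulerLog]
    rw [(summable_eulerLog hb hs).tsum_sub (summable_sum fun i _ ↦ hS i),
      Summable.tsum_finsetSum fun i _ ↦ hS i]
    simp only [tsum_mul_left, sub_add_cancel]

lemma differentiableOn_eulerLog_of_finite (ha : ∀ p, ‖a p‖ ≤ 1) (hf : {p | a p ≠ 0}.Finite) :
    DifferentiableOn ℂ (eulerLog a) {s | 0 < s.re} := by
  have e : eulerLog a = fun s ↦ ∑ p ∈ hf.toFinset, -log (1 - a p * (p : ℂ) ^ (-s)) := by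
    funext s
    refine tsum_eq_sum fun p hp ↦ ?_
    have : a p = 0 := by simpa using hp
    simp [this]
  rw [e]
  exact fun s hs ↦ (DifferentiableAt.fun_sum fun p _ ↦
    differentiableAt_log_one_sub_mul_prime_cpow p (ha p) hs).differentiableWithinAt

lemma tprod_inv_eq_exp_eulerLog (P : Nat.Primes → Prop) [DecidablePred P] {s : ℂ}
    (hs : 1 < s.re) :
    ∏' p : Nat.Primes, (if P p then (1 - (p : ℂ) ^ (-s))⁻¹ else 1) =
      exp (eulerLog (fun p ↦ if P p then 1 else 0) s) := by
  have hle (p : Nat.Primes) : ‖(if P p then 1 else 0 : ℂ)‖ ≤ 1 := by split_ifs <;> simp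
  rw [eulerLog, ← (summable_eulerLog hle hs).hasSum.cexp.tprod_eq]
  refine tprod_congr fun p ↦ ?_
  have h1 : ‖(p : ℂ) ^ (-s)‖ < 1 :=
    ((norm_prime_cpow_neg_le le_rfl).trans (prime_rpow_neg_le p (by linarith))).trans_lt
      (two_rpow_neg_lt_one (by linarith))
  have h2 : 1 - (p : ℂ) ^ (-s) ≠ 0 := by
    intro h
    rw [← sub_eq_zero.mp h, norm_one] at h1
    exact lt_irrefl _ h1
  split_ifs with h
  · simp [h, exp_neg, exp_log h2]
  · simp [h]

lemma eulerLog_add (a b : Nat.Primes → ℂ) (ha : ∀ p, ‖a p‖ ≤ 1) (hb : ∀ p, ‖b p‖ ≤ 1)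
    (hab : ∀ p, a p = 0 ∨ b p = 0) {s : ℂ} (hs : 1 < s.re) :
    eulerLog (fun p ↦ a p + b p) s = eulerLog a s + eulerLog b s := by
  simp only [eulerLog]
  rw [← (summable_eulerLog ha hs).tsum_add (summable_eulerLog hb hs)]
  refine tsum_congr fun p ↦ ?_
  rcases hab p with h | h <;> simp [h]

end EulerLog

section HolomorphicLog

lemma differentiableOn_of_continuousOn_log {U : Set ℂ} (hU : IsOpen U) {f L : ℂ → ℂ}
    (hf : ContinuousOn f U) (hL : DifferentiableOn ℂ L U) (h : ∀ s ∈ U, exp (f s) = L s) :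
    DifferentiableOn ℂ f U := by
  intro s hs
  have hUs := hU.mem_nhds hs
  have hLs : L s ≠ 0 := h s hs ▸ exp_ne_zero _
  have hd : DifferentiableAt ℂ (fun z ↦ log (L z / L s) + f s) s := by
    refine (((hL.differentiableAt hUs).div_const _).clog ?_).add_const _
    simp [hLs]
  have hfc : ContinuousAt (fun z ↦ (f z - f s).im) s :=
    continuous_im.continuousAt.comp ((hf.continuousAt hUs).sub continuousAt_const)
  have hlim : Filter.Tendsto (fun z ↦ (f z - f s).im) (nhds s) (nhds 0) := by
    simpa [ContinuousAt] using hfc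
  refine (hd.congr_of_eventuallyEq ?_).differentiableWithinAt
  filter_upwards [hUs, hlim.eventually (Ioo_mem_nhds (neg_lt_zero.mpr Real.pi_pos) Real.pi_pos)]
    with z hz hz'
  rw [← h z hz, ← h s hs, ← exp_sub, log_exp hz'.1 hz'.2.le, sub_add_cancel]

/-- A nonvanishing analytic function on a star-shaped open set has an analytic logarithm there,
which may be prescribed on a preconnected open subset. -/
lemma exists_differentiableOn_exp_eq {U V : Set ℂ} (hU : IsOpen U) {x : ℂ} (hx : x ∈ V)
    (hstar : StarConvex ℝ x U) (hV : IsOpen V) (hVc : IsPreconnected V) (hVU : V ⊆ U)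
    {L l : ℂ → ℂ} (hL : DifferentiableOn ℂ L U) (hL0 : ∀ s ∈ U, L s ≠ 0)
    (hl : DifferentiableOn ℂ l V) (hlL : ∀ s ∈ V, exp (l s) = L s) :
    ∃ f : ℂ → ℂ, DifferentiableOn ℂ f U ∧ ∀ s ∈ V, f s = l s := by
  have hc : ContractibleSpace U := hstar.contractibleSpace ⟨x, hVU hx⟩
  have hsc : IsSimplyConnected U := SimplyConnectedSpace.ofContractible U
  obtain ⟨f, hfc, hfe⟩ := exists_continuousOn_eqOn_exp_comp hsc hU hL.continuousOn
    (by rintro ⟨s, hs, h⟩; exact hL0 s hs h)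
  have hfd := differentiableOn_of_continuousOn_log hU hfc hL hfe
  have hd : DifferentiableOn ℂ (fun s ↦ f s - l s) V := (hfd.mono hVU).sub hl
  have hderiv : Set.EqOn (deriv fun s ↦ f s - l s) 0 V := by
    intro s hs
    have h1 := ((hd.differentiableAt (hV.mem_nhds hs)).hasDerivAt).cexp
    have h2 : HasDerivAt (fun s ↦ exp (f s - l s)) 0 s := by
      refine (hasDerivAt_const s (1 : ℂ)).congr_of_eventuallyEq ?_
      filter_upwards [hV.mem_nhds hs] with z hz
      rw [exp_sub, hlL z hz, ← hfe (hVU hz), Function.comp_apply, div_self (exp_ne_zero _)]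
    exact (mul_eq_zero.mp (h1.unique h2)).resolve_left (exp_ne_zero _)
  refine ⟨fun s ↦ f s - (f x - l x), hfd.sub_const _, fun s hs ↦ ?_⟩
  have := hV.is_const_of_deriv_eq_zero hVc hd hderiv hs hx
  linear_combination this

end HolomorphicLog

end

section Region

lemma logPlus_nonneg (y : ℝ) : 0 ≤ logPlus y := le_max_left _ _

lemma logPlus_eq_log_max {y : ℝ} (hy : 0 ≤ y) : logPlus y = Real.log (max 1 y) := by
  rcases le_total y 1 with h | h
  · rw [logPlus, max_eq_left h, Real.log_one, max_eq_left (Real.log_nonpos hy h)]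
  · rw [logPlus, max_eq_right h, max_eq_right (Real.log_nonneg h)]

lemma logPlus_le_logPlus {x y : ℝ} (hx : 0 ≤ x) (h : x ≤ y) : logPlus x ≤ logPlus y := by
  rw [logPlus_eq_log_max hx, logPlus_eq_log_max (hx.trans h)]
  exact Real.log_le_log (by positivity) (max_le_max le_rfl h)

/-- The interior of `sdRegion c`. -/
def sdInterior (c : ℝ) : Set ℂ := {s : ℂ | 1 - c / (1 + logPlus |s.im|) < s.re}

variable {c : ℝ}

lemma isOpen_sdInterior (c : ℝ) : IsOpen (sdInterior c) := by
  have h : Continuous fun s : ℂ ↦ logPlus |s.im| := by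
    simp_rw [logPlus_eq_log_max (abs_nonneg _)]
    refine Continuous.log (by fun_prop) fun s ↦ ?_
    positivity
  refine isOpen_lt (continuous_const.sub (continuous_const.div (continuous_const.add h)
    fun s ↦ ?_)) Complex.continuous_re
  linarith [logPlus_nonneg |s.im|]

lemma mem_sdInterior_of_one_lt_re (hc : 0 ≤ c) {s : ℂ} (hs : 1 < s.re) : s ∈ sdInterior c := by
  have : 0 ≤ c / (1 + logPlus |s.im|) := div_nonneg hc (by linarith [logPlus_nonneg |s.im|])
  simp only [sdInterior, Set.mem_ofPred_eq]
  linarith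

lemma sdRegion_subset_sdInterior {d : ℝ} (h : d < c) : sdRegion d ⊆ sdInterior c := by
  intro s hs
  have h0 : 0 < 1 + logPlus |s.im| := by linarith [logPlus_nonneg |s.im|]
  have := div_lt_div_of_pos_right h h0
  simp only [sdRegion, sdInterior, Set.mem_ofPred_eq] at hs ⊢
  linarith

lemma one_half_lt_re_of_mem_sdInterior (hc : 0 ≤ c) (hc' : c ≤ 1 / 2) {s : ℂ}
    (hs : s ∈ sdInterior c) : 1 / 2 < s.re := by
  have h : c / (1 + logPlus |s.im|) ≤ c := div_le_self hc (by linarith [logPlus_nonneg |s.im|])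
  simp only [sdInterior, Set.mem_ofPred_eq] at hs
  linarith

lemma starConvex_sdInterior (hc : 0 ≤ c) : StarConvex ℝ 2 (sdInterior c) := by
  intro s hs u v hu hv huv
  simp only [sdInterior, Set.mem_ofPred_eq, Complex.real_smul, Complex.add_re, Complex.add_im,
    Complex.re_ofReal_mul, Complex.im_ofReal_mul, Complex.re_ofNat, Complex.im_ofNat, mul_zero,
    zero_add] at hs ⊢
  have hv1 : v ≤ 1 := by linarith
  have h1 : |v * s.im| ≤ |s.im| := by
    rw [abs_mul, abs_of_nonneg hv]
    exact mul_le_of_le_one_left (abs_nonneg _) hv1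
  have h2 := logPlus_le_logPlus (abs_nonneg _) h1
  have h3 := logPlus_nonneg |v * s.im|
  have h4 : c / (1 + logPlus |s.im|) ≤ c / (1 + logPlus |v * s.im|) :=
    div_le_div_of_nonneg_left hc (by linarith) (by linarith)
  have h5 : 0 ≤ c / (1 + logPlus |s.im|) := div_nonneg hc (by linarith)
  obtain rfl : u = 1 - v := by linarith
  rcases hv.eq_or_lt with rfl | hv0
  · norm_num at h4 ⊢
    linarith
  · nlinarith [mul_lt_mul_of_pos_left hs hv0, mul_nonneg hu h5]

end Region

lemma logZeta_eq_eulerLog {s : ℂ} (hs : 1 < s.re) : logZeta s = eulerLog (fun _ ↦ 1) s := by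
  have hone (x : ZMod 1) : (1 : DirichletCharacter ℂ 1) x = 1 :=
    MulChar.one_apply <| isUnit_of_subsingleton _
  have h := DirichletCharacter.eulerProduct_log_eq_LSeries (1 : DirichletCharacter ℂ 1) hs
  rw [LSeries_def₀ (by simp)] at h
  simp only [hone, one_mul] at h
  simp only [eulerLog, one_mul]
  rw [h, logZeta]
  refine tsum_congr fun n ↦ ?_
  rw [div_div, mul_comm]

namespace DirichletCharacter

variable {q : ℕ}

lemma exp_eulerLog [NeZero q] (χ : DirichletCharacter ℂ q) {s : ℂ} (hs : 1 < s.re) :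
    Complex.exp (eulerLog (fun p ↦ χ p) s) = LFunction χ s := by
  rw [LFunction_eq_LSeries χ hs, ← LSeries_eulerProduct_exp_log χ hs, eulerLog]

lemma indicator_eq_sum [NeZero q] (A : Finset (ZMod q)) (hA : ∀ a ∈ A, IsUnit a) (b : ZMod q) :
    (if b ∈ A then 1 else 0 : ℂ) =
      ∑ χ : DirichletCharacter ℂ q, (∑ a ∈ A, χ a⁻¹) / q.totient * χ b := by
  have hq : (q.totient : ℂ) ≠ 0 := mod_cast (Nat.totient_pos.mpr (NeZero.pos q)).ne'
  have h : ∑ χ : DirichletCharacter ℂ q, (∑ a ∈ A, χ a⁻¹) * χ b =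
      q.totient * (if b ∈ A then 1 else 0 : ℂ) := by
    simp_rw [Finset.sum_mul]
    rw [Finset.sum_comm, Finset.sum_congr rfl fun a ha ↦ sum_char_inv_mul_char_eq ℂ (hA a ha) b]
    simp [Finset.sum_ite_eq']
  simp_rw [div_mul_eq_mul_div]
  rw [← Finset.sum_div, h, mul_div_cancel_left₀ _ hq]

lemma sum_one_inv (A : Finset (ZMod q)) (hA : ∀ a ∈ A, IsUnit a) :
    ∑ a ∈ A, (1 : DirichletCharacter ℂ q) a⁻¹ = A.card := by
  have h (a : ZMod q) (ha : a ∈ A) : (1 : DirichletCharacter ℂ q) a⁻¹ = 1 := by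
    obtain ⟨u, rfl⟩ := hA a ha
    rw [ZMod.inv_coe_unit]
    exact MulChar.one_apply_coe _
  simp [Finset.sum_congr rfl h]

lemma eulerLog_one_eq {s : ℂ} (hs : 1 < s.re) :
    eulerLog (fun _ ↦ 1) s = eulerLog (fun p ↦ (1 : DirichletCharacter ℂ q) p) s +
      eulerLog (fun p ↦ if (p : ℕ) ∣ q then 1 else 0) s := by
  have hd (p : Nat.Primes) : (1 : DirichletCharacter ℂ q) p = if (p : ℕ) ∣ q then 0 else 1 := by
    split_ifs with h
    · exact MulChar.map_nonunit _ (by rwa [ZMod.isUnit_prime_iff_not_dvd p.2, not_not])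
    · exact MulChar.one_apply ((ZMod.isUnit_prime_iff_not_dvd p.2).mpr h)
  rw [← eulerLog_add _ _ (fun p ↦ norm_le_one _ _) (fun p ↦ by split_ifs <;> simp)
    (fun p ↦ by rw [hd]; split_ifs <;> simp) hs]
  congr 1
  funext p
  rw [hd]
  split_ifs <;> simp

lemma finite_primes_dvd [NeZero q] :
    {p : Nat.Primes | (if (p : ℕ) ∣ q then 1 else 0 : ℂ) ≠ 0}.Finite := by
  refine Set.Finite.of_injOn (f := fun p : Nat.Primes ↦ (p : ℕ)) (t := (q.divisors : Set ℕ))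
    (fun p hp ↦ ?_) Subtype.val_injective.injOn (Finset.finite_toSet _)
  have : (p : ℕ) ∣ q := by simpa using hp
  simpa using ⟨this, NeZero.ne q⟩

/-- The generating function `GB` extends to any star-shaped open set containing `1 < re s` and
contained in `1 / 2 < re s` on which no nonprincipal Dirichlet `L`-function vanishes. -/
lemma exists_differentiableOn_eq_GB [NeZero q] (A : Finset (ZMod q)) (hA : ∀ a ∈ A, IsUnit a)
    {U : Set ℂ} (hU : IsOpen U) (hstar : StarConvex ℝ 2 U) (h1 : ∀ s : ℂ, 1 < s.re → s ∈ U)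
    (h2 : ∀ s ∈ U, 1 / 2 < s.re)
    (hL : ∀ χ : DirichletCharacter ℂ q, χ ≠ 1 → ∀ s ∈ U, LFunction χ s ≠ 0) :
    ∃ g : ℂ → ℂ, DifferentiableOn ℂ g U ∧ ∀ s : ℂ, 1 < s.re → g s = GB q A s := by
  classical
  have hlog (χ : DirichletCharacter ℂ q) (hχ : χ ≠ 1) : ∃ f : ℂ → ℂ, DifferentiableOn ℂ f U ∧
      ∀ s ∈ {s : ℂ | 1 < s.re}, f s = eulerLog (fun p ↦ χ p) s :=
    exists_differentiableOn_exp_eq hU (x := 2) (by simp) hstar (isOpen_lt_re 1)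
      (convex_halfSpace_re_gt 1).isPreconnected h1
      (differentiable_LFunction hχ).differentiableOn (hL χ hχ)
      (differentiableOn_eulerLog fun p ↦ norm_le_one _ _) fun s hs ↦ exp_eulerLog χ hs
  choose! f hfd hfe using hlog
  let c : DirichletCharacter ℂ q → ℂ := fun χ ↦ (∑ a ∈ A, χ a⁻¹) / q.totient
  obtain ⟨H, hHd, hH⟩ := exists_eulerLog_eq_add_sum Finset.univ c
    (b := fun p ↦ if ((p : ℕ) : ZMod q) ∈ A then 1 else 0)
    (α := fun χ p ↦ χ p) (fun p ↦ by split_ifs <;> simp) (fun χ p ↦ norm_le_one _ _)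
    fun p ↦ indicator_eq_sum A hA _
  let D : ℂ → ℂ := eulerLog fun p ↦ if (p : ℕ) ∣ q then 1 else 0
  have hDd : DifferentiableOn ℂ D {s | 0 < s.re} :=
    differentiableOn_eulerLog_of_finite (fun p ↦ by split_ifs <;> simp) finite_primes_dvd
  refine ⟨fun s ↦ Complex.exp (-((A.card : ℂ) / q.totient) * D s +
    (H s + ∑ χ ∈ Finset.univ.erase 1, c χ * f χ s)), ?_, fun s hs ↦ ?_⟩
  · refine (((hDd.mono fun s hs ↦ ?_).const_mul _).add ((hHd.mono fun s hs ↦ h2 s hs).add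
      (DifferentiableOn.fun_sum fun χ hχ ↦ ?_))).cexp
    · exact lt_trans (by norm_num) (h2 s hs)
    · exact (hfd χ (Finset.ne_of_mem_erase hχ)).const_mul _
  · rw [GB, logZeta_eq_eulerLog hs, eulerLog_one_eq (q := q) hs,
      tprod_inv_eq_exp_eulerLog (fun p ↦ ((p : ℕ) : ZMod q) ∈ A) hs, hH s hs, ← Complex.exp_add,
      ← Finset.add_sum_erase _ _ (Finset.mem_univ (1 : DirichletCharacter ℂ q))]
    have hsum : ∑ χ ∈ Finset.univ.erase 1, c χ * f χ s =
        ∑ χ ∈ Finset.univ.erase 1, c χ * eulerLog (fun p ↦ χ p) s :=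
      Finset.sum_congr rfl fun χ hχ ↦ by rw [hfe χ (Finset.ne_of_mem_erase hχ) s hs]
    have hc1 : c 1 = A.card / q.totient := by simp only [c, sum_one_inv A hA]
    simp only [hsum, hc1, D]
    congr 1
    ring

end DirichletCharacter

theorem stmt3 : ∃ η : ℝ, 0 < η ∧ η < 1 / 81 ∧
    ∀ (q : ℕ), 3 ≤ q → ∀ A : Finset (ZMod q), (∀ a ∈ A, IsUnit a) → 1 ≤ A.card →
      ∃ (U : Set ℂ) (g : ℂ → ℂ), IsOpen U ∧
        sdRegion (η / (Real.sqrt q * Real.log q ^ 2)) ⊆ U ∧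
        AnalyticOnNhd ℂ g U ∧
        ∀ s : ℂ, 1 < s.re → g s = GB q A s := by
  refine ⟨1 / 10 ^ 12, by norm_num, by norm_num, fun q hq A hA _ ↦ ?_⟩
  have : NeZero q := ⟨by omega⟩
  have hlog : 1 ≤ Real.log q := DirichletCharacter.one_le_log_natCast hq
  have hsqrt : 1 ≤ Real.sqrt q := Real.one_le_sqrt.mpr (by exact_mod_cast (by omega : 1 ≤ q))
  have hX : 1 ≤ Real.sqrt q * Real.log q ^ 2 :=
    one_le_mul_of_one_le_of_one_le hsqrt (one_le_pow₀ hlog)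
  have hX0 : 0 < Real.sqrt q * Real.log q ^ 2 := by linarith
  set c : ℝ := 1 / (10 ^ 11 * (Real.sqrt q * Real.log q ^ 2)) with hc
  have hc0 : 0 ≤ c := by positivity
  have hc1 : c ≤ 1 / 2 := by
    rw [hc]
    exact one_div_le_one_div_of_le (by norm_num) (by linarith)
  obtain ⟨g, hgd, hg⟩ := DirichletCharacter.exists_differentiableOn_eq_GB A hA
    (isOpen_sdInterior c) (starConvex_sdInterior hc0)
    (fun s hs ↦ mem_sdInterior_of_one_lt_re hc0 hs)
    (fun s hs ↦ one_half_lt_re_of_mem_sdInterior hc0 hc1 hs)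
    fun χ hχ s hs ↦ DirichletCharacter.LFunction_ne_zero_of_zeroFree hq hχ hs
  refine ⟨sdInterior c, g, isOpen_sdInterior c, sdRegion_subset_sdInterior ?_,
    hgd.analyticOnNhd (isOpen_sdInterior c), hg⟩
  rw [hc, one_div (_ * _), mul_inv, ← div_eq_mul_inv]
  exact div_lt_div_of_pos_right (by norm_num) hX0
end
end

section
/- There is an absolute constant C > 0 such that G_q ≤ C·(log q)/φ(q) for every integer q ≥ 3. -/
noncomputable section

open scoped Classical in
/-- The constant `G_q` of the paper. -/
def Gq (q : ℕ) : ℝ :=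
  if hq : q = 0 then 0 else
    haveI : NeZero q := ⟨hq⟩
    (1 / Real.Gamma (1 / q.totient)) *
      (((q.totient : ℝ) / q) *
          (∏ χ : DirichletCharacter ℂ q,
            if χ ≠ 1 then DirichletCharacter.LFunction χ 1 else 1).re) ^
        ((1 : ℝ) / q.totient) *
      ∏' p : Nat.Primes,
        (if ¬(p : ℕ) ∣ q ∧ (((p : ℕ) : ZMod q) ≠ 1) then
          (1 - ((p : ℕ) : ℝ) ^ (-(orderOf (((p : ℕ) : ZMod q)) : ℝ))) ^
            ((1 : ℝ) / (orderOf (((p : ℕ) : ZMod q)) : ℝ))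
        else 1)

open scoped Classical in
/-- The constant `H_q` of the paper. -/
def Hq (q : ℕ) : ℝ :=
  if h : ∃ p : ℕ, p.Prime ∧ p ≠ 2 ∧ p ∣ q ∧ (q / p ^ (q.factorization p)) ∣ (p - 1) then
    3 * Gq q / 2 *
      (1 + 1 / ((h.choose : ℝ) ^ (q.factorization h.choose) * ((h.choose : ℝ) - 1)))
  else 3 * Gq q / 2

open Filter Topology

theorem sum_range_dirichletCharacter_eq_zero {q : ℕ} [NeZero q] {χ : DirichletCharacter ℂ q}
    (hχ : χ ≠ 1) : ∑ a ∈ Finset.range q, χ (a : ZMod q) = 0 := by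
  rw [← MulChar.sum_eq_zero_of_ne_one hχ]
  refine Finset.sum_bij' (fun a _ ↦ (a : ZMod q)) (fun x _ ↦ x.val) (by simp)
    (fun x _ ↦ Finset.mem_range.mpr x.val_lt)
    (fun a ha ↦ ZMod.val_cast_of_lt (Finset.mem_range.mp ha)) (by simp) (by simp)

/-- Abel summation, carried out over complete residue systems. -/
theorem norm_sum_range_mul_le {q : ℕ} [NeZero q] {χ : DirichletCharacter ℂ q} (hχ : χ ≠ 1)
    {f : ℕ → ℝ} (hf : ∀ m n, 0 < m → m ≤ n → f n ≤ f m) (M : ℕ) :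
    ‖∑ n ∈ Finset.range (q * (M + 1)), χ (n : ZMod q) * (f n : ℂ)‖ ≤
      ∑ n ∈ Finset.range q, |f n| + q * (f q - f (q * (M + 1))) := by
  have hq : 0 < q := NeZero.pos q
  induction M with
  | zero =>
    simp only [zero_add, mul_one, sub_self, mul_zero, add_zero]
    refine (norm_sum_le _ _).trans (Finset.sum_le_sum fun n _ ↦ ?_)
    rw [norm_mul, Complex.norm_real, Real.norm_eq_abs]
    exact mul_le_of_le_one_left (abs_nonneg _) (χ.norm_le_one _)
  | succ M ih =>
    set N := q * (M + 1) with hN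
    have hN0 : 0 < N := by positivity
    have hN' : q * (M + 1 + 1) = N + q := by ring
    rw [hN', Finset.sum_range_add]
    have hblock : ∑ a ∈ Finset.range q, χ ((N + a : ℕ) : ZMod q) * (f (N + a) : ℂ) =
        ∑ a ∈ Finset.range q, χ (a : ZMod q) * ((f (N + a) - f N : ℝ) : ℂ) := by
      have hcast (a : ℕ) : ((N + a : ℕ) : ZMod q) = a := by simp [hN]
      simp only [hcast, Complex.ofReal_sub, mul_sub, Finset.sum_sub_distrib, ← Finset.sum_mul,
        sum_range_dirichletCharacter_eq_zero hχ, zero_mul, sub_zero]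
    have hbound : ‖∑ a ∈ Finset.range q, χ ((N + a : ℕ) : ZMod q) * (f (N + a) : ℂ)‖ ≤
        q * (f N - f (N + q)) := by
      rw [hblock]
      refine (norm_sum_le_of_le (f := fun a : ℕ ↦ χ (a : ZMod q) * ((f (N + a) - f N : ℝ) : ℂ))
        (n := fun _ ↦ f N - f (N + q)) _ fun a ha ↦ ?_).trans_eq (by simp [mul_sub])
      have ha' := Finset.mem_range.mp ha
      rw [norm_mul, Complex.norm_real, Real.norm_eq_abs]
      refine (mul_le_of_le_one_left (abs_nonneg _) (χ.norm_le_one _)).trans ?_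
      rw [abs_le]
      have h1 := hf N (N + a) hN0 (by omega)
      have h2 := hf (N + a) (N + q) (by omega) (by omega)
      constructor <;> linarith
    linarith [norm_add_le (∑ n ∈ Finset.range N, χ (n : ZMod q) * (f n : ℂ))
      (∑ a ∈ Finset.range q, χ ((N + a : ℕ) : ZMod q) * (f (N + a) : ℂ))]

theorem sum_range_inv_le_one_add_log (q : ℕ) :
    ∑ n ∈ Finset.range q, ((n : ℝ))⁻¹ ≤ 1 + Real.log q := by
  rcases q with _ | q
  · simp
  · rw [Finset.sum_range_succ']
    have h := harmonic_le_one_add_log q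
    simp only [harmonic, Rat.cast_sum, Rat.cast_inv, Rat.cast_natCast] at h
    have : Real.log q ≤ Real.log (q + 1 : ℕ) := by
      rcases q.eq_zero_or_pos with rfl | hq
      · simp
      · exact Real.log_le_log (by positivity) (by simp)
    simp only [Nat.cast_zero, inv_zero, add_zero]
    linarith

theorem norm_LFunction_le_of_one_lt {q : ℕ} [NeZero q] {χ : DirichletCharacter ℂ q}
    (hχ : χ ≠ 1) {s : ℝ} (hs : 1 < s) :
    ‖χ.LFunction s‖ ≤ 2 + Real.log q := by
  have hq : 0 < q := NeZero.pos q
  have hs' : 1 < (s : ℂ).re := by simpa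
  set f : ℕ → ℝ := fun n ↦ if n = 0 then 0 else (n : ℝ) ^ (-s) with hf
  have hf0 (n : ℕ) : 0 ≤ f n := by simp only [hf]; split_ifs <;> positivity
  have hf_le (n : ℕ) : f n ≤ (n : ℝ)⁻¹ := by
    simp only [hf]
    split_ifs with h
    · simp [h]
    · rw [← Real.rpow_neg_one]
      exact Real.rpow_le_rpow_of_exponent_le (by exact_mod_cast Nat.one_le_iff_ne_zero.mpr h)
        (by linarith)
  have hanti (m n : ℕ) (hm : 0 < m) (hmn : m ≤ n) : f n ≤ f m := by
    simp only [hf, hm.ne', (hm.trans_le hmn).ne', if_false]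
    exact Real.rpow_le_rpow_of_nonpos (by exact_mod_cast hm) (by exact_mod_cast hmn)
      (by linarith)
  rw [DirichletCharacter.LFunction_eq_LSeries χ hs']
  have hterm : LSeries.term (fun n ↦ χ (n : ZMod q)) s =
      fun n : ℕ ↦ χ (n : ZMod q) * (f n : ℂ) := by
    ext n
    rcases eq_or_ne n 0 with rfl | hn
    · simp [hf]
    · rw [LSeries.term_of_ne_zero hn]
      simp only [hf, hn, if_false, Complex.ofReal_cpow n.cast_nonneg, Complex.ofReal_neg,
        Complex.ofReal_natCast, Complex.cpow_neg, div_eq_mul_inv]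
  have hlim := (DirichletCharacter.LSeriesSummable_of_one_lt_re χ hs').hasSum.tendsto_sum_nat
  rw [hterm] at hlim
  have hsub : Tendsto (fun M : ℕ ↦ q * (M + 1)) atTop atTop :=
    (tendsto_add_atTop_nat 1).const_mul_atTop' hq
  have hL := (hlim.comp hsub).norm
  rw [LSeries, hterm]
  refine le_of_tendsto hL (Eventually.of_forall fun M ↦ ?_)
  refine (norm_sum_range_mul_le hχ hanti M).trans ?_
  have h1 : ∑ n ∈ Finset.range q, |f n| ≤ 1 + Real.log q := by
    refine (Finset.sum_le_sum fun n _ ↦ ?_).trans (sum_range_inv_le_one_add_log q)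
    rw [abs_of_nonneg (hf0 n)]
    exact hf_le n
  have h2 : (q : ℝ) * (f q - f (q * (M + 1))) ≤ 1 := by
    have hq' : (0 : ℝ) < q := by exact_mod_cast hq
    calc (q : ℝ) * (f q - f (q * (M + 1))) ≤ q * (q : ℝ)⁻¹ := by
          gcongr; linarith [hf_le q, hf0 (q * (M + 1))]
      _ = 1 := mul_inv_cancel₀ hq'.ne'
  linarith

theorem norm_LFunction_one_le {q : ℕ} [NeZero q] {χ : DirichletCharacter ℂ q} (hχ : χ ≠ 1) :
    ‖χ.LFunction 1‖ ≤ 2 + Real.log q := by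
  have hcont : Continuous fun s : ℝ ↦ ‖χ.LFunction s‖ :=
    ((DirichletCharacter.differentiable_LFunction hχ).continuous.comp
      Complex.continuous_ofReal).norm
  have hlim : Tendsto (fun s : ℝ ↦ ‖χ.LFunction s‖) (𝓝[>] 1) (𝓝 ‖χ.LFunction 1‖) := by
    simpa using hcont.continuousWithinAt.tendsto (x := (1 : ℝ)) (s := Set.Ioi 1)
  exact le_of_tendsto hlim (eventually_mem_nhdsWithin.mono fun s hs ↦
    norm_LFunction_le_of_one_lt hχ hs)

theorem exists_one_div_Gamma_le :
    ∃ C : ℝ, 0 < C ∧ ∀ x : ℝ, 0 < x → x ≤ 1 → 1 / Real.Gamma x ≤ C * x := by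
  obtain ⟨y, hy, hmin⟩ := isCompact_Icc.exists_isMinOn (Set.nonempty_Icc.mpr one_le_two)
    (f := Real.Gamma) (s := Set.Icc (1 : ℝ) 2) <|
      Real.differentiableOn_Gamma_Ioi.continuousOn.mono fun x hx ↦
        Set.mem_Ioi.mpr (by linarith [hx.1])
  have hy0 : 0 < Real.Gamma y := Real.Gamma_pos_of_pos (by linarith [hy.1])
  refine ⟨(Real.Gamma y)⁻¹, inv_pos.mpr hy0, fun x hx hx1 ↦ ?_⟩
  have h : Real.Gamma y ≤ Real.Gamma (x + 1) :=
    hmin (Set.mem_Icc.mpr ⟨by linarith, by linarith⟩)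
  rw [Real.Gamma_add_one hx.ne'] at h
  have := Real.Gamma_pos_of_pos hx
  rw [div_le_iff₀ this, mul_assoc, le_inv_mul_iff₀ hy0, mul_one]
  exact h

theorem tprod_le_one_of_nonneg {ι : Type*} {f : ι → ℝ} (h0 : ∀ i, 0 ≤ f i) (h1 : ∀ i, f i ≤ 1) :
    ∏' i, f i ≤ 1 := by
  by_cases h : Multipliable f
  · exact le_of_tendsto h.hasProd (Eventually.of_forall fun s ↦
      Finset.prod_le_one (fun i _ ↦ h0 i) fun i _ ↦ h1 i)
  · rw [tprod_eq_one_of_not_multipliable h]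

theorem tprod_nonneg_of_nonneg {ι : Type*} {f : ι → ℝ} (h0 : ∀ i, 0 ≤ f i) :
    0 ≤ ∏' i, f i := by
  by_cases h : Multipliable f
  · exact ge_of_tendsto h.hasProd (Eventually.of_forall fun s ↦
      Finset.prod_nonneg fun i _ ↦ h0 i)
  · rw [tprod_eq_one_of_not_multipliable h]
    exact zero_le_one

theorem stmt8 : ∃ C : ℝ, 0 < C ∧
    ∀ q : ℕ, 3 ≤ q → Gq q ≤ C * Real.log q / (q.totient : ℝ) := by
  obtain ⟨C, hC, hGamma⟩ := exists_one_div_Gamma_le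
  refine ⟨C * 3, by positivity, fun q hq ↦ ?_⟩
  have hq0 : q ≠ 0 := by omega
  have : NeZero q := ⟨hq0⟩
  have hφ : 0 < q.totient := Nat.totient_pos.mpr (by omega)
  have hφ' : (0 : ℝ) < q.totient := by exact_mod_cast hφ
  have hφ1 : (1 : ℝ) ≤ q.totient := by exact_mod_cast hφ
  have hlog : 1 ≤ Real.log q := by
    rw [Real.le_log_iff_exp_le (by positivity)]
    have : (3 : ℝ) ≤ q := by exact_mod_cast hq
    linarith [Real.exp_one_lt_d9]
  rw [Gq, dif_neg hq0]
  have hG0 : 0 ≤ 1 / Real.Gamma (1 / q.totient) :=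
    one_div_nonneg.mpr (Real.Gamma_pos_of_pos (by positivity)).le
  have hG : 1 / Real.Gamma (1 / q.totient) ≤ C * (1 / q.totient) :=
    hGamma _ (by positivity) (by rw [div_le_one hφ']; exact hφ1)
  set P : ℂ := ∏ χ : DirichletCharacter ℂ q,
    if χ ≠ 1 then DirichletCharacter.LFunction χ 1 else 1 with hPdef
  have hP : ‖P‖ ≤ (3 * Real.log q) ^ q.totient := by
    rw [hPdef, norm_prod]
    refine (Finset.prod_le_prod (g := fun _ ↦ 3 * Real.log q) (fun _ _ ↦ norm_nonneg _)
      fun χ _ ↦ ?_).trans_eq ?_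
    · split_ifs with hχ
      · linarith [norm_LFunction_one_le hχ]
      · rw [norm_one]
        linarith
    · rw [Finset.prod_const, Finset.card_univ, ← Nat.card_eq_fintype_card,
        DirichletCharacter.card_eq_totient_of_hasEnoughRootsOfUnity]
  have hbase : |(q.totient : ℝ) / q * P.re| ≤ (3 * Real.log q) ^ q.totient := by
    rw [abs_mul, abs_of_nonneg (by positivity)]
    refine (mul_le_of_le_one_left (abs_nonneg _) ?_).trans ((Complex.abs_re_le_norm P).trans hP)
    exact div_le_one_of_le₀ (by exact_mod_cast q.totient_le) (by positivity)
  have hpow : |((q.totient : ℝ) / q * P.re) ^ ((1 : ℝ) / q.totient)| ≤ 3 * Real.log q := by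
    refine (Real.abs_rpow_le_abs_rpow _ _).trans
      ((Real.rpow_le_rpow (abs_nonneg _) hbase (by positivity)).trans_eq ?_)
    rw [one_div, Real.pow_rpow_inv_natCast (by positivity) hφ.ne']
  have hfactor (p : Nat.Primes) :
      0 ≤ 1 - ((p : ℕ) : ℝ) ^ (-(orderOf (((p : ℕ) : ZMod q)) : ℝ)) ∧
        1 - ((p : ℕ) : ℝ) ^ (-(orderOf (((p : ℕ) : ZMod q)) : ℝ)) ≤ 1 := by
    have h1 : (1 : ℝ) ≤ (p : ℕ) := by exact_mod_cast p.2.one_le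
    exact ⟨sub_nonneg.mpr (Real.rpow_le_one_of_one_le_of_nonpos h1 (by simp)),
      sub_le_self _ (by positivity)⟩
  set F : Nat.Primes → ℝ := fun p ↦
    if ¬(p : ℕ) ∣ q ∧ (((p : ℕ) : ZMod q) ≠ 1) then
      (1 - ((p : ℕ) : ℝ) ^ (-(orderOf (((p : ℕ) : ZMod q)) : ℝ))) ^
        ((1 : ℝ) / (orderOf (((p : ℕ) : ZMod q)) : ℝ))
    else 1 with hF
  have hF0 (p : Nat.Primes) : 0 ≤ F p := by
    simp only [hF]
    split_ifs
    · exact Real.rpow_nonneg (hfactor p).1 _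
    · exact zero_le_one
  have hF1 (p : Nat.Primes) : F p ≤ 1 := by
    simp only [hF]
    split_ifs
    · exact Real.rpow_le_one (hfactor p).1 (hfactor p).2 (by positivity)
    · exact le_rfl
  calc _ ≤ (C * (1 / q.totient)) * (3 * Real.log q) * 1 := by
        refine (mul_le_mul_of_nonneg_right
          (mul_le_mul_of_nonneg_left ((le_abs_self _).trans hpow) hG0)
          (tprod_nonneg_of_nonneg hF0)).trans ?_
        gcongr
        · exact tprod_nonneg_of_nonneg hF0
        · exact tprod_le_one_of_nonneg hF0 hF1
    _ = C * 3 * Real.log q / q.totient := by ring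
end
end
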